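/- arXiv:2305.08617 — 4 statements merged into one kernel-verified Lean document; each statement's English description precedes it below -/
import Mathlib

section
/- Let X be a finite group that factorizes as X = G·C where G is a dihedral group of order 2n (n ≥ 2), C is a cyclic group of order m ≥ 2, and G ∩ C = 1. Then X is solvable. -/
/-- `A` is a cyclic subgroup of `G` of index at most two, and every element of `G` outside `A` is an
involution which inverts `A`. -/
structure IsCyclicByInversion {X : Type*} [Group X] (A G : Subgroup X) : Prop where
  le : A ≤ G
  cyclic : IsCyclic A
  mul_self : ∀ g ∈ G, g ∉ A → g * g = 1
  conj : ∀ g ∈ G, g ∉ A → ∀ x ∈ A, g * x * g⁻¹ = x⁻¹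
  mul_mem : ∀ g ∈ G, ∀ h ∈ G, g ∉ A → h ∉ A → g * h ∈ A

theorem mem_zpowers_of_orderOf_eq {X : Type*} [Group X] [Finite X] {A : Subgroup X}
    (hA : IsCyclic A) {s t : X} (hs : s ∈ A) (ht : t ∈ A) (h : orderOf s = orderOf t) :
    s ∈ Subgroup.zpowers t := by
  classical
  have := Fintype.ofFinite X
  lift s to A using hs
  lift t to A using ht
  rw [Subgroup.orderOf_coe, Subgroup.orderOf_coe] at h
  have hsub : (Subgroup.zpowers t : Set A).toFinset ⊆
      Finset.univ.filter fun x : A => x ^ orderOf t = 1 := by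
    intro x hx
    obtain ⟨k, rfl⟩ : x ∈ Subgroup.zpowers t := by simpa using hx
    rw [Finset.mem_filter_univ, ← zpow_natCast, zpow_comm, zpow_natCast, pow_orderOf_eq_one,
      one_zpow]
  have hcard : (Subgroup.zpowers t : Set A).toFinset.card = orderOf t := by
    rw [Set.toFinset_card, ← Nat.card_eq_fintype_card]
    exact Nat.card_zpowers t
  have heq := Finset.eq_of_subset_of_card_le hsub
    ((IsCyclic.card_pow_eq_one_le (orderOf_pos t)).trans hcard.ge)
  have hmem : s ∈ (Subgroup.zpowers t : Set A).toFinset := by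
    rw [heq]
    simp [← h]
  obtain ⟨k, hk⟩ : s ∈ Subgroup.zpowers t := by simpa using hmem
  exact ⟨k, by simpa using congrArg Subtype.val hk⟩

theorem mul_comm_of_isCyclic {X : Type*} [Group X] {A : Subgroup X} (hA : IsCyclic A)
    {x y : X} (hx : x ∈ A) (hy : y ∈ A) : x * y = y * x := by
  have h : (⟨x, hx⟩ : A) * ⟨y, hy⟩ = ⟨y, hy⟩ * ⟨x, hx⟩ := IsCyclic.commGroup.mul_comm _ _
  exact congrArg Subtype.val h

theorem isSolvable_of_isCyclic {X : Type*} [Group X] (h : IsCyclic X) : Group.IsSolvable X :=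
  Group.isSolvable_of_comm IsCyclic.commGroup.mul_comm

namespace IsCyclicByInversion

variable {X : Type*} [Group X] {A G : Subgroup X}

theorem isSolvable (h : IsCyclicByInversion A G) : Group.IsSolvable G := by
  have hA : Group.IsSolvable A := isSolvable_of_isCyclic h.cyclic
  refine Group.isSolvable_of_ker_le_range (Subgroup.inclusion h.le)
    (Abelianization.of : G →* Abelianization G) ?_
  rw [Abelianization.ker_of, Subgroup.inclusion_range, commutator_def, Subgroup.commutator_le]
  rintro ⟨x, hx⟩ - ⟨y, hy⟩ -
  rw [Subgroup.mem_subgroupOf]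
  change x * y * x⁻¹ * y⁻¹ ∈ A
  by_cases hxA : x ∈ A <;> by_cases hyA : y ∈ A
  · exact A.mul_mem (A.mul_mem (A.mul_mem hxA hyA) (A.inv_mem hxA)) (A.inv_mem hyA)
  · have := h.conj y hy hyA _ (A.inv_mem hxA)
    rw [show x * y * x⁻¹ * y⁻¹ = x * (y * x⁻¹ * y⁻¹) by group, this]
    exact A.mul_mem hxA (A.inv_mem (A.inv_mem hxA))
  · rw [h.conj x hx hxA _ hyA]
    exact A.mul_mem (A.inv_mem hyA) (A.inv_mem hyA)
  · rw [show x * y * x⁻¹ * y⁻¹ = (x * y) * (y * x)⁻¹ by group]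
    exact A.mul_mem (h.mul_mem x hx y hy hxA hyA) (A.inv_mem (h.mul_mem y hy x hx hyA hxA))

theorem map {Y : Type*} [Group Y] (h : IsCyclicByInversion A G) (f : X →* Y) :
    IsCyclicByInversion (A.map f) (G.map f) where
  le := Subgroup.map_mono h.le
  cyclic := by
    have := h.cyclic
    exact isCyclic_of_surjective (f.subgroupMap A) (f.subgroupMap_surjective A)
  mul_self := by
    rintro _ ⟨g, hg, rfl⟩ hgA
    rw [← map_mul, h.mul_self g hg fun hA => hgA ⟨g, hA, rfl⟩, map_one]
  conj := by
    rintro _ ⟨g, hg, rfl⟩ hgA _ ⟨x, hx, rfl⟩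
    rw [← map_inv, ← map_mul, ← map_mul, h.conj g hg (fun hA => hgA ⟨g, hA, rfl⟩) x hx, map_inv]
  mul_mem := by
    rintro _ ⟨g, hg, rfl⟩ _ ⟨k, hk, rfl⟩ hgA hkA
    exact ⟨g * k, h.mul_mem g hg k hk (fun hA => hgA ⟨g, hA, rfl⟩) fun hA => hkA ⟨k, hA, rfl⟩,
      map_mul f g k⟩

theorem subgroupOf (h : IsCyclicByInversion A G) (M : Subgroup X) :
    IsCyclicByInversion (A.subgroupOf M) (G.subgroupOf M) where
  le := fun x hx => h.le hx
  cyclic := by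
    have := h.cyclic
    refine isCyclic_of_injective
      ((M.subtype.comp (A.subgroupOf M).subtype).codRestrict A fun x => x.2) ?_
    intro x y hxy
    exact Subtype.ext (Subtype.ext (congrArg (fun z : A => (z : X)) hxy))
  mul_self := fun g hg hgA => Subtype.ext (h.mul_self g hg hgA)
  conj := fun g hg hgA x hx => Subtype.ext (h.conj g hg hgA x hx)
  mul_mem := fun g hg k hk hgA hkA => h.mul_mem g hg k hk hgA hkA

theorem card_le [Finite X] (h : IsCyclicByInversion A G) : Nat.card G ≤ 2 * Nat.card A := by
  by_cases hGA : G ≤ A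
  · rw [le_antisymm hGA h.le]
    lia
  · obtain ⟨b, hb, hbA⟩ := SetLike.not_le_iff_exists.1 hGA
    have hmem : ∀ x : G, (x : X) ∉ A → b * x ∈ A := fun x hx => h.mul_mem b hb x x.2 hbA hx
    classical
    let f : G → Bool × A := fun x =>
      if hx : (x : X) ∈ A then (true, ⟨x, hx⟩) else (false, ⟨b * x, hmem x hx⟩)
    have hf : Function.Injective f := by
      intro x y hxy
      simp only [f] at hxy
      split_ifs at hxy <;> simp_all
    have := Nat.card_le_card_of_injective f hf
    simpa [Nat.card_prod] using this

theorem conj_mem_zpowers (h : IsCyclicByInversion A G) {t g : X} (ht : t ∈ A) (hg : g ∈ G) :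
    g * t * g⁻¹ ∈ Subgroup.zpowers t := by
  by_cases hgA : g ∈ A
  · rw [mul_comm_of_isCyclic h.cyclic hgA ht, mul_inv_cancel_right]
    exact Subgroup.mem_zpowers t
  · rw [h.conj g hg hgA t ht]
    exact Subgroup.inv_mem _ (Subgroup.mem_zpowers t)

end IsCyclicByInversion

theorem mem_normalizer_zpowers {X : Type*} [Group X] [Finite X] {t x : X}
    (h : x * t * x⁻¹ ∈ Subgroup.zpowers t) :
    x ∈ Subgroup.normalizer (Subgroup.zpowers t : Set X) := by
  refine Subgroup.mem_normalizer_fintype ?_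
  rintro _ ⟨k, rfl⟩
  change x * t ^ k * x⁻¹ ∈ Subgroup.zpowers t
  rw [← conj_zpow]
  exact Subgroup.zpow_mem _ h k

/-- A factorization `X = G * C` of a non-solvable group as in a minimal counterexample. -/
structure IsCriticalFactorization {X : Type*} [Group X] (A G C : Subgroup X) : Prop where
  inversion : IsCyclicByInversion A G
  cyclic : IsCyclic C
  exists_mul : ∀ x : X, ∃ g ∈ G, ∃ c ∈ C, x = g * c
  not_isSolvable : ¬ Group.IsSolvable X
  eq_bot : ∀ H : Subgroup X, H.Normal → Group.IsSolvable H → H = ⊥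
  isSolvable : ∀ M : Subgroup X, M ≠ ⊤ → G ≤ M ∨ C ≤ M → Group.IsSolvable M

namespace IsCriticalFactorization

variable {X : Type*} [Group X] {A G C : Subgroup X}

theorem ne_top_of_isSolvable (h : IsCriticalFactorization A G C) {M : Subgroup X}
    (hM : Group.IsSolvable M) : M ≠ ⊤ := by
  rintro rfl
  exact h.not_isSolvable
    (Group.isSolvable_of_surjective (f := (⊤ : Subgroup X).subtype) fun x => ⟨⟨x, trivial⟩, rfl⟩)

theorem left_ne_top (h : IsCriticalFactorization A G C) : G ≠ ⊤ :=
  h.ne_top_of_isSolvable h.inversion.isSolvable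

theorem exists_mul' (h : IsCriticalFactorization A G C) (x : X) :
    ∃ c ∈ C, ∃ g ∈ G, x = c * g := by
  obtain ⟨g, hg, c, hc, hx⟩ := h.exists_mul x⁻¹
  exact ⟨c⁻¹, C.inv_mem hc, g⁻¹, G.inv_mem hg, by rw [← mul_inv_rev, ← hx, inv_inv]⟩

theorem eq_one_of_forall_conj_mem (h : IsCriticalFactorization A G C) {M : Subgroup X}
    (hM : M ≠ ⊤) (hle : G ≤ M ∨ C ≤ M) {t : X} (ht : ∀ x : X, x * t * x⁻¹ ∈ M) : t = 1 := by
  have hs := h.isSolvable M hM hle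
  have hbot := h.eq_bot M.normalCore M.normalCore_normal
    (Group.isSolvable_of_isSolvable_injective (Subgroup.inclusion_injective M.normalCore_le))
  have : t ∈ M.normalCore := ht
  rwa [hbot, Subgroup.mem_bot] at this

theorem eq_of_le (h : IsCriticalFactorization A G C) {M : Subgroup X}
    (hM : M ≠ ⊤) (hle : G ≤ M) : M = G := by
  refine le_antisymm (fun y hy => ?_) hle
  obtain ⟨g, hg, c, hc, rfl⟩ := h.exists_mul y
  have hcM : c ∈ M := by simpa using M.mul_mem (M.inv_mem (hle hg)) hy
  have hc1 : c = 1 := by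
    refine h.eq_one_of_forall_conj_mem hM (Or.inl hle) fun x => ?_
    obtain ⟨k, hk, d, hd, rfl⟩ := h.exists_mul x
    rw [show k * d * c * (k * d)⁻¹ = k * (d * c * d⁻¹) * k⁻¹ by group,
      mul_comm_of_isCyclic h.cyclic hd hc, mul_inv_cancel_right]
    exact M.mul_mem (M.mul_mem (hle hk) hcM) (M.inv_mem (hle hk))
  simpa [hc1] using hg

theorem eq_one_of_mem (h : IsCriticalFactorization A G C) {c : X} (hc : c ∈ C) (hcG : c ∈ G) :
    c = 1 := by
  refine h.eq_one_of_forall_conj_mem h.left_ne_top (Or.inl le_rfl) fun x => ?_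
  obtain ⟨k, hk, d, hd, rfl⟩ := h.exists_mul x
  rw [show k * d * c * (k * d)⁻¹ = k * (d * c * d⁻¹) * k⁻¹ by group,
    mul_comm_of_isCyclic h.cyclic hd hc, mul_inv_cancel_right]
  exact G.mul_mem (G.mul_mem hk hcG) (G.inv_mem hk)

theorem mul_right_eq (h : IsCriticalFactorization A G C) {g g' c c' : X} (hg : g ∈ G)
    (hg' : g' ∈ G) (hc : c ∈ C) (hc' : c' ∈ C) (heq : g * c = g' * c') : g = g' ∧ c = c' := by
  have h1 : g'⁻¹ * g = c' * c⁻¹ := by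
    rw [eq_mul_inv_iff_mul_eq, mul_assoc, heq, inv_mul_cancel_left]
  have h2 : c' * c⁻¹ = 1 :=
    h.eq_one_of_mem (C.mul_mem hc' (C.inv_mem hc)) (h1 ▸ G.mul_mem (G.inv_mem hg') hg)
  have h3 : c' = c := mul_inv_eq_one.1 h2
  subst h3
  exact ⟨mul_right_cancel heq, rfl⟩

theorem card_eq (h : IsCriticalFactorization A G C) :
    Nat.card X = Nat.card G * Nat.card C := by
  rw [← Nat.card_prod]
  symm
  refine Nat.card_eq_of_bijective (fun p : G × C => (p.1 * p.2 : X)) ⟨?_, ?_⟩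
  · rintro ⟨g, c⟩ ⟨g', c'⟩ heq
    obtain ⟨h1, h2⟩ := h.mul_right_eq g.2 g'.2 c.2 c'.2 heq
    exact Prod.ext (Subtype.ext h1) (Subtype.ext h2)
  · intro x
    obtain ⟨g, hg, c, hc, rfl⟩ := h.exists_mul x
    exact ⟨(⟨g, hg⟩, ⟨c, hc⟩), rfl⟩

theorem not_normal_of_ne_bot (h : IsCriticalFactorization A G C) {H : Subgroup X}
    (hH : Group.IsSolvable H) (hne : H ≠ ⊥) : ¬ H.Normal :=
  fun hn => hne (h.eq_bot H hn hH)

theorem not_normal_left (h : IsCriticalFactorization A G C) : ¬ G.Normal := by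
  intro hn
  have hG := h.eq_bot G hn h.inversion.isSolvable
  refine h.ne_top_of_isSolvable (isSolvable_of_isCyclic h.cyclic) ((Subgroup.eq_top_iff' C).2 ?_)
  intro x
  obtain ⟨g, hg, c, hc, rfl⟩ := h.exists_mul x
  rw [hG, Subgroup.mem_bot] at hg
  simpa [hg] using hc

variable [Finite X]

theorem normalizer_zpowers_eq (h : IsCriticalFactorization A G C) {t : X} (ht : t ∈ A)
    (ht1 : t ≠ 1) : Subgroup.normalizer (Subgroup.zpowers t : Set X) = G := by
  refine h.eq_of_le (fun htop => ?_)
    fun g hg => mem_normalizer_zpowers (h.inversion.conj_mem_zpowers ht hg)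
  refine h.not_normal_of_ne_bot (H := Subgroup.zpowers t)
    (isSolvable_of_isCyclic inferInstance) ?_ (Subgroup.normalizer_eq_top_iff.1 htop)
  rwa [Ne, Subgroup.zpowers_eq_bot]

theorem eq_one_of_commute (h : IsCriticalFactorization A G C) {t c : X} (ht : t ∈ A)
    (hc : c ∈ C) (hc1 : c ≠ 1) (hcomm : Commute c t) : t = 1 := by
  by_contra ht1
  refine hc1 (h.eq_one_of_mem hc ?_)
  rw [← h.normalizer_zpowers_eq ht ht1]
  apply mem_normalizer_zpowers
  rw [hcomm.eq, mul_inv_cancel_right]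
  exact Subgroup.mem_zpowers t

theorem mul_self_mem_of_commute (h : IsCriticalFactorization A G C) {c y : X}
    (hc : c ∈ C) (hc1 : c ≠ 1) (hcomm : Commute c y) : y * y ∈ C := by
  have key : ∀ g ∈ G, g ≠ 1 → Commute c g → g ∉ A := fun g _ hg1 hcg hgA =>
    hg1 (h.eq_one_of_commute hgA hc hc1 hcg)
  have hCc : ∀ d ∈ C, Commute c d := fun d hd => mul_comm_of_isCyclic h.cyclic hc hd
  obtain ⟨g, hg, d, hd, hy⟩ := h.exists_mul y
  obtain ⟨k, hk, e, he, hyy⟩ := h.exists_mul (y * y)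
  have hcg : Commute c g := by
    rw [eq_mul_inv_of_mul_eq hy.symm]
    exact hcomm.mul_right (hCc d hd).inv_right
  have hck : Commute c k := by
    rw [eq_mul_inv_of_mul_eq hyy.symm]
    exact (hcomm.mul_right hcomm).mul_right (hCc e he).inv_right
  by_cases hg1 : g = 1
  · rw [hy, hg1, one_mul]
    exact C.mul_mem hd hd
  by_cases hk1 : k = 1
  · rwa [hyy, hk1, one_mul]
  have hgk : g * k = 1 := h.eq_one_of_commute
    (h.inversion.mul_mem g hg k hk (key g hg hg1 hcg) (key k hk hk1 hck)) hc hc1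
    (hcg.mul_right hck)
  have hgg := h.inversion.mul_self g hg (key g hg hg1 hcg)
  have hkg : k = g := mul_left_cancel (hgk.trans hgg.symm)
  have hyC : y ∈ C := by
    have h1 : g * (d * y) = g * e := by
      rw [← mul_assoc, ← hy, hyy, hkg]
    have h2 : y = d⁻¹ * e := eq_inv_mul_of_mul_eq (mul_left_cancel h1)
    rw [h2]
    exact C.mul_mem (C.inv_mem hd) he
  exact C.mul_mem hyC hyC

theorem mem_normalizer_of_conj_mem (h : IsCriticalFactorization A G C) {y c x : X}
    (hy : y ∈ C) (hc : c ∈ C) (hc1 : c ≠ 1) (hx : x * c * x⁻¹ ∈ C) :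
    x ∈ Subgroup.normalizer (Subgroup.zpowers (y * y) : Set X) := by
  have hcomm : Commute (x * c * x⁻¹) (x * y * x⁻¹) := by
    have : Commute c y := mul_comm_of_isCyclic h.cyclic hc hy
    simpa using this.map (MulAut.conj x)
  have hmem := h.mul_self_mem_of_commute hx (by simpa using hc1) hcomm
  rw [conj_mul] at hmem
  apply mem_normalizer_zpowers
  refine mem_zpowers_of_orderOf_eq h.cyclic hmem (C.mul_mem hy hy) ?_
  simpa using MulEquiv.orderOf_eq (MulAut.conj x) (y * y)

theorem card_left_le_card_right (h : IsCriticalFactorization A G C) :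
    Nat.card A ≤ Nat.card C := by
  obtain ⟨x, hx⟩ : ∃ x : X, ∀ t ∈ A, x * t * x⁻¹ ∈ G → t = 1 := by
    by_contra! hcon
    have hinv : ∀ x ∉ G, ∃ t ∈ A, t ≠ 1 ∧ x * t * x⁻¹ ∈ G ∧ t * t = 1 := by
      intro x hx
      obtain ⟨t, htA, htG, ht1⟩ := hcon x
      refine ⟨t, htA, ht1, htG, ?_⟩
      by_cases hmem : x * t * x⁻¹ ∈ A
      · exfalso
        have hconj : x * t * x⁻¹ ≠ 1 := by simpa using ht1
        have hN : x ∈ Subgroup.normalizer (G : Set X) := by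
          refine Subgroup.mem_normalizer_fintype fun g hg => ?_
          rw [SetLike.mem_coe] at hg ⊢
          rw [← h.normalizer_zpowers_eq hmem hconj]
          apply mem_normalizer_zpowers
          obtain ⟨k, hk⟩ := h.inversion.conj_mem_zpowers htA hg
          refine ⟨k, ?_⟩
          simp only at hk ⊢
          rw [conj_zpow, hk]
          group
        refine hx ((h.eq_of_le (fun htop => ?_) Subgroup.le_normalizer) ▸ hN)
        exact h.not_normal_left (Subgroup.normalizer_eq_top_iff.1 htop)
      · have := h.inversion.mul_self _ htG hmem
        rw [conj_mul] at this
        simpa using this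
    obtain ⟨x₀, -, hx₀⟩ := SetLike.exists_of_lt (lt_top_iff_ne_top.2 h.left_ne_top)
    obtain ⟨t, htA, ht1, -, htt⟩ := hinv x₀ hx₀
    refine ht1 (h.eq_one_of_forall_conj_mem h.left_ne_top (Or.inl le_rfl) fun x => ?_)
    by_cases hx : x ∈ G
    · exact G.mul_mem (G.mul_mem hx (h.inversion.le htA)) (G.inv_mem hx)
    · obtain ⟨s, hsA, hs1, hsG, hss⟩ := hinv x hx
      have ht2 : orderOf t = 2 := orderOf_eq_prime (by rwa [sq]) ht1
      have hs2 : orderOf s = 2 := orderOf_eq_prime (by rwa [sq]) hs1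
      obtain ⟨k, hk⟩ := mem_zpowers_of_orderOf_eq h.inversion.cyclic htA hsA (ht2.trans hs2.symm)
      simp only at hk
      rw [← hk, ← conj_zpow]
      exact G.zpow_mem hsG k
  have hinj : Function.Injective (fun p : A × G => ((p.2 : X) * x * p.1 : X)) := by
    rintro ⟨s, g⟩ ⟨t, k⟩ heq
    simp only at heq
    have h1 : x * (s * (t : X)⁻¹) * x⁻¹ = (g : X)⁻¹ * k := by
      rw [eq_inv_mul_iff_mul_eq, ← mul_assoc, ← mul_assoc, ← mul_assoc, heq]
      group
    have h2 : (s : X) * (t : X)⁻¹ = 1 :=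
      hx _ (A.mul_mem s.2 (A.inv_mem t.2)) (h1 ▸ G.mul_mem (G.inv_mem g.2) k.2)
    have h3 : (s : X) = t := mul_inv_eq_one.1 h2
    rw [h3] at heq
    exact Prod.ext (Subtype.ext h3) (Subtype.ext (mul_right_cancel (mul_right_cancel heq)))
  have := Nat.card_le_card_of_injective _ hinj
  rw [Nat.card_prod, h.card_eq, mul_comm] at this
  exact Nat.le_of_mul_le_mul_left this Nat.card_pos

theorem eq_one_of_conj_mem (h : IsCriticalFactorization A G C) :
    ∀ x ∉ C, ∀ c ∈ C, x * c * x⁻¹ ∈ C → c = 1 := by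
  obtain ⟨⟨y, hyC⟩, hy⟩ := h.cyclic
  set N := Subgroup.normalizer (Subgroup.zpowers (y * y) : Set X)
  have hNC : ∀ x ∉ N, ∀ c ∈ C, x * c * x⁻¹ ∈ C → c = 1 := fun x hx c hc hxc => by
    by_contra hc1
    exact hx (h.mem_normalizer_of_conj_mem hyC hc hc1 hxc)
  have hCN : C ≤ N := fun c hc => by
    apply mem_normalizer_zpowers
    rw [mul_comm_of_isCyclic h.cyclic hc (C.mul_mem hyC hyC), mul_inv_cancel_right]
    exact Subgroup.mem_zpowers _
  have hNtop : N ≠ ⊤ := by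
    intro htop
    have hbot := h.eq_bot _ (Subgroup.normalizer_eq_top_iff.1 htop)
      (isSolvable_of_isCyclic inferInstance)
    rw [Subgroup.zpowers_eq_bot] at hbot
    have hcard : Nat.card C ≤ 2 := by
      rw [← orderOf_eq_card_of_forall_mem_zpowers hy]
      refine orderOf_le_of_pow_eq_one two_pos (Subtype.ext ?_)
      simpa [sq] using hbot
    have hindex : G.index ≤ 2 := by
      have := G.card_mul_index
      rw [h.card_eq] at this
      rwa [Nat.eq_of_mul_eq_mul_left Nat.card_pos this]
    have hpos : G.index ≠ 0 := Subgroup.index_ne_zero_of_finite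
    have hne1 : G.index ≠ 1 := fun h1 => h.left_ne_top (Subgroup.index_eq_one.1 h1)
    exact h.not_normal_left (Subgroup.normal_of_index_eq_two (by lia))
  obtain ⟨z, -, hz⟩ := SetLike.exists_of_lt (lt_top_iff_ne_top.2 hNtop)
  have hinj : ∀ x ∉ N, ∀ c₁ ∈ C, ∀ c₂ ∈ C, ∀ d₁ ∈ C, ∀ d₂ ∈ C,
      c₁ * x * c₂ = d₁ * x * d₂ → c₁ = d₁ ∧ c₂ = d₂ := by
    intro x hx c₁ hc₁ c₂ hc₂ d₁ hd₁ d₂ hd₂ heq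
    have h1 : x * (c₂ * d₂⁻¹) * x⁻¹ = c₁⁻¹ * d₁ := by
      rw [eq_inv_mul_iff_mul_eq, ← mul_assoc, ← mul_assoc, ← mul_assoc, heq]
      group
    have h2 := hNC x hx _ (C.mul_mem hc₂ (C.inv_mem hd₂))
      (h1 ▸ C.mul_mem (C.inv_mem hc₁) hd₁)
    rw [mul_inv_eq_one] at h2
    subst h2
    exact ⟨mul_right_cancel (mul_right_cancel heq), rfl⟩
  have hout : ∀ x ∉ N, ∀ c₁ ∈ C, ∀ c₂ ∈ C, c₁ * x * c₂ ∉ N := by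
    intro x hx c₁ hc₁ c₂ hc₂ hmem
    rw [N.mul_mem_cancel_right (hCN hc₂), N.mul_mem_cancel_left (hCN hc₁)] at hmem
    exact hx hmem
  have hdouble : ∀ x ∉ N, ∃ c₁ ∈ C, ∃ c₂ ∈ C, x = c₁ * z * c₂ := by
    intro x hx
    by_contra! hcon
    let f : (C × C) ⊕ (C × C) → X :=
      Sum.elim (fun p => p.1 * z * p.2) (fun p => p.1 * x * p.2)
    have hne : ∀ p q : C × C, (p.1 * z * p.2 : X) ≠ q.1 * x * q.2 := by
      intro p q heq
      refine hcon ((q.1 : X)⁻¹ * p.1) (C.mul_mem (C.inv_mem q.1.2) p.1.2)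
        (p.2 * (q.2 : X)⁻¹) (C.mul_mem p.2.2 (C.inv_mem q.2.2)) ?_
      rw [show (q.1 : X)⁻¹ * p.1 * z * (p.2 * (q.2 : X)⁻¹)
        = (q.1 : X)⁻¹ * (p.1 * z * p.2) * (q.2 : X)⁻¹ by group, heq]
      group
    have hf : Function.Injective f := by
      have haux : ∀ w ∉ N, Function.Injective (fun p : C × C => (p.1 * w * p.2 : X)) := by
        intro w hw p q heq
        obtain ⟨h1, h2⟩ := hinj w hw _ p.1.2 _ p.2.2 _ q.1.2 _ q.2.2 heq
        exact Prod.ext (Subtype.ext h1) (Subtype.ext h2)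
      exact Function.Injective.sumElim (haux z hz) (haux x hx) hne
    have hlt : Nat.card ((C × C) ⊕ (C × C)) < Nat.card X := by
      refine lt_of_le_of_ne (Nat.card_le_card_of_injective f hf) fun hcard => ?_
      obtain ⟨p | p, hp⟩ := (hf.bijective_of_nat_card_le hcard.ge).2 1
      · exact hout z hz _ p.1.2 _ p.2.2 ((show (p.1 * z * p.2 : X) = 1 from hp) ▸ N.one_mem)
      · exact hout x hx _ p.1.2 _ p.2.2 ((show (p.1 * x * p.2 : X) = 1 from hp) ▸ N.one_mem)
    rw [Nat.card_sum, Nat.card_prod, h.card_eq] at hlt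
    have h1 := h.inversion.card_le
    have h2 := h.card_left_le_card_right
    nlinarith
  have hcore : ∀ c ∈ C, z⁻¹ * c * z ∈ N → c = 1 := by
    intro c hc hzc
    refine h.eq_one_of_forall_conj_mem hNtop (Or.inr hCN) fun x => ?_
    by_cases hx : x ∈ N
    · exact N.mul_mem (N.mul_mem hx (hCN hc)) (N.inv_mem hx)
    · obtain ⟨c₁, hc₁, c₂, hc₂, heq⟩ := hdouble x⁻¹ fun hx' => hx (N.inv_mem_iff.1 hx')
      have hx' : x = c₂⁻¹ * z⁻¹ * c₁⁻¹ := by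
        rw [← inv_inv x, heq]
        group
      have hcc : c₁⁻¹ * c * c₁ = c := by
        rw [mul_comm_of_isCyclic h.cyclic (C.inv_mem hc₁) hc, inv_mul_cancel_right]
      rw [hx', show c₂⁻¹ * z⁻¹ * c₁⁻¹ * c * (c₂⁻¹ * z⁻¹ * c₁⁻¹)⁻¹
        = c₂⁻¹ * (z⁻¹ * (c₁⁻¹ * c * c₁) * z) * c₂ by group, hcc]
      exact N.mul_mem (N.mul_mem (N.inv_mem (hCN hc₂)) hzc) (hCN hc₂)
  have hNleC : N ≤ C := by
    intro v hv
    have hzv : z * v ∉ N := by rwa [N.mul_mem_cancel_right hv]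
    obtain ⟨c₁, hc₁, c₂, hc₂, heq⟩ := hdouble _ hzv
    have h1 : c₁ = 1 := by
      refine hcore c₁ hc₁ ?_
      rw [show z⁻¹ * c₁ * z = z⁻¹ * (c₁ * z * c₂) * c₂⁻¹ by group, ← heq, inv_mul_cancel_left]
      exact N.mul_mem hv (N.inv_mem (hCN hc₂))
    rw [h1, one_mul] at heq
    rwa [mul_left_cancel heq]
  exact fun x hx => hNC x fun hxN => hx (hNleC hxN)

theorem false (h : IsCriticalFactorization A G C) : False := by
  classical
  have hTI := h.eq_one_of_conj_mem
  have hnot : ∀ g ∈ G, ∀ c ∈ C, c ≠ 1 → g * c * g⁻¹ ∉ G := by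
    intro g hg c hc hc1 hmem
    rw [G.mul_mem_cancel_right (G.inv_mem hg), G.mul_mem_cancel_left hg] at hmem
    exact hc1 (h.eq_one_of_mem hc hmem)
  -- conjugates of nontrivial elements of `C`, together with `G`, exhaust the group
  let f : G × C → X := fun p => if p.2 = 1 then p.1 else p.1 * p.2 * (p.1 : X)⁻¹
  have hf : Function.Injective f := by
    rintro ⟨g, c⟩ ⟨k, d⟩ heq
    simp only [f] at heq
    split_ifs at heq with h1 h2 h2
    · rw [h1, h2, Subtype.ext heq]
    · exact absurd (heq ▸ g.2) (hnot k k.2 d d.2 fun hd => h2 (Subtype.ext hd))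
    · exact absurd (heq ▸ k.2) (hnot g g.2 c c.2 fun hc => h1 (Subtype.ext hc))
    · have hconj : ((k : X)⁻¹ * g) * c * ((k : X)⁻¹ * g)⁻¹ = d := by
        rw [show ((k : X)⁻¹ * g) * c * ((k : X)⁻¹ * g)⁻¹ = (k : X)⁻¹ * (g * c * (g : X)⁻¹) * k by
          group, heq]
        group
      have hmem : (k : X)⁻¹ * g ∈ C := by
        by_contra hkg
        exact h1 (Subtype.ext (hTI _ hkg c c.2 (hconj ▸ d.2)))
      have hgk : (g : X) = k := (inv_mul_eq_one.1
        (h.eq_one_of_mem hmem (G.mul_mem (G.inv_mem k.2) g.2))).symm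
      rw [hgk] at heq
      exact Prod.ext (Subtype.ext hgk)
        (Subtype.ext (mul_left_cancel (mul_right_cancel heq)))
  have hsurj := (hf.bijective_of_nat_card_le (by rw [h.card_eq, Nat.card_prod])).2
  refine h.not_normal_left ⟨fun g hg x => ?_⟩
  by_contra hmem
  obtain ⟨⟨k, c⟩, hkc⟩ := hsurj (x * g * x⁻¹)
  simp only [f] at hkc
  split_ifs at hkc with hc1
  · exact hmem (hkc ▸ k.2)
  · obtain ⟨d, hd, u, hu, hdu⟩ := h.exists_mul' ((k : X)⁻¹ * x)
    have hc : (c : X) = d * (u * g * u⁻¹) * d⁻¹ := by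
      rw [show d * (u * g * u⁻¹) * d⁻¹ = (d * u) * g * (d * u)⁻¹ by group, ← hdu,
        show ((k : X)⁻¹ * x) * g * ((k : X)⁻¹ * x)⁻¹ = (k : X)⁻¹ * (x * g * x⁻¹) * k by group, ← hkc]
      group
    have hu' : u * g * u⁻¹ = d⁻¹ * c * d := by
      rw [hc]
      group
    have h1 := h.eq_one_of_mem (C.mul_mem (C.mul_mem (C.inv_mem hd) c.2) hd)
      (hu' ▸ G.mul_mem (G.mul_mem hu hg) (G.inv_mem hu))
    refine hc1 (Subtype.ext ?_)
    rw [hc, hu', h1]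
    simp

end IsCriticalFactorization

theorem isSolvable_of_isCyclicByInversion_mul_isCyclic {X : Type*} [Group X] [Finite X]
    {A G C : Subgroup X} (hG : IsCyclicByInversion A G) (hC : IsCyclic C)
    (hfact : ∀ x : X, ∃ g ∈ G, ∃ c ∈ C, x = g * c) : Group.IsSolvable X := by
  induction hN : Nat.card X using Nat.strong_induction_on generalizing X with
  | _ N ih =>
  subst hN
  by_contra hns
  have hnorm : ∀ H : Subgroup X, H.Normal → Group.IsSolvable H → H = ⊥ := by
    intro H _ hH
    by_contra hne
    refine hns ((Group.isSolvable_iff_subgroup_quotient H).2 ⟨hH, ?_⟩)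
    refine ih (Nat.card (X ⧸ H)) ?_ (hG.map (QuotientGroup.mk' H)) (C := C.map (QuotientGroup.mk' H))
      (isCyclic_of_surjective _ ((QuotientGroup.mk' H).subgroupMap_surjective C)) ?_ rfl
    · rw [Subgroup.card_eq_card_quotient_mul_card_subgroup H]
      exact lt_mul_of_one_lt_right Nat.card_pos
        ((Subgroup.one_lt_card_iff_ne_bot H).2 hne)
    · intro x
      obtain ⟨x, rfl⟩ := QuotientGroup.mk'_surjective H x
      obtain ⟨g, hg, c, hc, rfl⟩ := hfact x
      exact ⟨_, Subgroup.mem_map_of_mem _ hg, _, Subgroup.mem_map_of_mem _ hc, map_mul _ _ _⟩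
  have hsub : ∀ M : Subgroup X, M ≠ ⊤ → G ≤ M ∨ C ≤ M → Group.IsSolvable M := by
    intro M hM hle
    have hcyc : IsCyclic (C.subgroupOf M) := by
      refine isCyclic_of_injective
        ((M.subtype.comp (C.subgroupOf M).subtype).codRestrict C fun x => x.2) ?_
      intro x y hxy
      exact Subtype.ext (Subtype.ext (congrArg (fun z : C => (z : X)) hxy))
    refine ih (Nat.card M) ?_ (hG.subgroupOf M) hcyc ?_ rfl
    · exact lt_of_le_of_ne (Subgroup.card_le_card_group M) fun h => hM (Subgroup.eq_top_of_card_eq M h)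
    · rintro ⟨x, hx⟩
      obtain ⟨g, hg, c, hc, rfl⟩ := hfact x
      have hgc : g ∈ M ∧ c ∈ M := by
        rcases hle with hle | hle
        · exact ⟨hle hg, (M.mul_mem_cancel_left (hle hg)).1 hx⟩
        · exact ⟨(M.mul_mem_cancel_right (hle hc)).1 hx, hle hc⟩
      exact ⟨⟨g, hgc.1⟩, hg, ⟨c, hgc.2⟩, hc, rfl⟩
  exact IsCriticalFactorization.false (A := A) (G := G) (C := C)
    ⟨hG, hC, hfact, hns, hnorm, hsub⟩

theorem isCyclicByInversion_closure_pair {X : Type*} [Group X] {a b : X} (hb : b * b = 1)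
    (hrel : b * a * b⁻¹ = a⁻¹) :
    IsCyclicByInversion (Subgroup.zpowers a) (Subgroup.closure {a, b}) := by
  have hinv : b⁻¹ = b := inv_eq_of_mul_eq_one_right hb
  have hconj : ∀ x ∈ Subgroup.zpowers a, b * x * b⁻¹ = x⁻¹ := by
    rintro _ ⟨k, rfl⟩
    simp only
    rw [← conj_zpow, hrel, inv_zpow]
  have hform : ∀ g ∈ Subgroup.closure {a, b},
      g ∈ Subgroup.zpowers a ∨ ∃ x ∈ Subgroup.zpowers a, g = x * b := by
    have hmul : ∀ g, (g ∈ Subgroup.zpowers a ∨ ∃ x ∈ Subgroup.zpowers a, g = x * b) →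
        ∀ w ∈ Subgroup.zpowers a,
          g * w ∈ Subgroup.zpowers a ∨ ∃ x ∈ Subgroup.zpowers a, g * w = x * b := by
      rintro g (hg | ⟨x, hx, rfl⟩) w hw
      · exact Or.inl (Subgroup.mul_mem _ hg hw)
      · refine Or.inr ⟨x * w⁻¹, Subgroup.mul_mem _ hx (Subgroup.inv_mem _ hw), ?_⟩
        rw [← hconj w hw]
        group
    have hmulb : ∀ g, (g ∈ Subgroup.zpowers a ∨ ∃ x ∈ Subgroup.zpowers a, g = x * b) →
        g * b ∈ Subgroup.zpowers a ∨ ∃ x ∈ Subgroup.zpowers a, g * b = x * b := by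
      rintro g (hg | ⟨x, hx, rfl⟩)
      · exact Or.inr ⟨g, hg, rfl⟩
      · exact Or.inl (by rwa [mul_assoc, hb, mul_one])
    intro g hg
    induction hg using Subgroup.closure_induction_right with
    | one => exact Or.inl (Subgroup.one_mem _)
    | mul_right g _ y hy ih =>
      rcases hy with rfl | rfl
      · exact hmul g ih _ (Subgroup.mem_zpowers _)
      · exact hmulb g ih
    | mul_inv_cancel g _ y hy ih =>
      rcases hy with rfl | rfl
      · exact hmul g ih _ (Subgroup.inv_mem _ (Subgroup.mem_zpowers _))
      · rw [hinv]
        exact hmulb g ih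
  have hform' : ∀ g ∈ Subgroup.closure {a, b}, g ∉ Subgroup.zpowers a →
      ∃ x ∈ Subgroup.zpowers a, g = x * b := fun g hg hgA => (hform g hg).resolve_left hgA
  have hprod : ∀ x ∈ Subgroup.zpowers a, ∀ y ∈ Subgroup.zpowers a,
      x * b * (y * b) = x * y⁻¹ := by
    intro x _ y hy
    rw [← hconj y hy, hinv]
    group
  refine ⟨?_, inferInstance, ?_, ?_, ?_⟩
  · rw [Subgroup.zpowers_le]
    exact Subgroup.subset_closure (Set.mem_insert a {b})
  · intro g hg hgA
    obtain ⟨x, hx, rfl⟩ := hform' g hg hgA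
    rw [hprod x hx x hx, mul_inv_cancel]
  · intro g hg hgA y hy
    obtain ⟨x, hx, rfl⟩ := hform' g hg hgA
    rw [show x * b * y * (x * b)⁻¹ = x * (b * y * b⁻¹) * x⁻¹ by group, hconj y hy,
      mul_comm_of_isCyclic inferInstance hx (Subgroup.inv_mem _ hy), mul_inv_cancel_right]
  · intro g hg k hk hgA hkA
    obtain ⟨x, hx, rfl⟩ := hform' g hg hgA
    obtain ⟨y, hy, rfl⟩ := hform' k hk hkA
    rw [hprod x hx y hy]
    exact Subgroup.mul_mem _ hx (Subgroup.inv_mem _ hy)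

/-- The product of a dihedral group and a cyclic group intersecting trivially is solvable. -/
theorem solvable_of_dihedral_mul_cyclic {X : Type*} [Group X] [Finite X]
    (G C : Subgroup X) (n m : ℕ) (hn : 2 ≤ n) (hm : 2 ≤ m)
    (a b : X) (hGgen : G = Subgroup.closure {a, b})
    (hoa : orderOf a = n) (hob : orderOf b = 2)
    (hrel : b * a * b⁻¹ = a⁻¹)
    (hcardG : Nat.card G = 2 * n)
    (hC : IsCyclic C) (hcardC : Nat.card C = m)
    (hint : G ⊓ C = ⊥)
    (hfact : ∀ x : X, ∃ g ∈ G, ∃ c ∈ C, x = g * c) :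
    IsSolvable X := by
  refine isSolvable_of_isCyclicByInversion_mul_isCyclic (A := Subgroup.zpowers a) (G := G) ?_ hC
    hfact
  rw [hGgen]
  refine isCyclicByInversion_closure_pair ?_ hrel
  rw [← sq, ← hob, pow_orderOf_eq_one]
end

section
/- Let X be a finite group that factorizes as X = Q·C where Q is a generalized quaternion group of order 4n (n ≥ 2), C is a cyclic group, and Q ∩ C = 1. Then X is solvable. -/
/-- `A` is a cyclic subgroup of index at most two in `D`. -/
structure IsCyclicOfIndexLETwo {G : Type*} [Group G] (A D : Subgroup G) : Prop where
  le : A ≤ D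
  isCyclic : IsCyclic A
  mul_mem : ∀ x ∈ D, ∀ y ∈ D, x ∉ A → y ∉ A → x * y ∈ A

namespace IsCyclicOfIndexLETwo

variable {G : Type*} [Group G] {A D : Subgroup G}

theorem of_isCyclic (hA : IsCyclic A) : IsCyclicOfIndexLETwo A A :=
  ⟨le_rfl, hA, fun _ hx _ _ h => absurd hx h⟩

theorem map {H : Type*} [Group H] (h : IsCyclicOfIndexLETwo A D) (f : G →* H) :
    IsCyclicOfIndexLETwo (A.map f) (D.map f) := by
  refine ⟨Subgroup.map_mono h.le, ?_, ?_⟩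
  · have := h.isCyclic
    exact isCyclic_of_surjective (f.subgroupMap A) (f.subgroupMap_surjective A)
  · rintro _ ⟨x, hx, rfl⟩ _ ⟨y, hy, rfl⟩ hxA hyA
    rw [← map_mul]
    exact Subgroup.mem_map_of_mem f (h.mul_mem x hx y hy
      (fun hh => hxA (Subgroup.mem_map_of_mem f hh)) (fun hh => hyA (Subgroup.mem_map_of_mem f hh)))

theorem subgroupOf (h : IsCyclicOfIndexLETwo A D) (M : Subgroup G) :
    IsCyclicOfIndexLETwo (A.subgroupOf M) (D.subgroupOf M) := by
  refine ⟨Subgroup.comap_mono h.le, ?_, fun x hx y hy hxA hyA => h.mul_mem x hx y hy hxA hyA⟩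
  have := h.isCyclic
  exact isCyclic_of_injective (M.subtype.subgroupComap A)
    fun x y hxy => Subtype.ext (Subtype.ext (congrArg (fun z : A => (z : G)) hxy))

theorem sq_mem (h : IsCyclicOfIndexLETwo A D) {x : G} (hx : x ∈ D) : x * x ∈ A := by
  by_cases hxA : x ∈ A
  · exact A.mul_mem hxA hxA
  · exact h.mul_mem x hx x hx hxA hxA

theorem conj_mem (h : IsCyclicOfIndexLETwo A D) {x y : G} (hx : x ∈ D) (hy : y ∈ A) :
    x * y * x⁻¹ ∈ A := by
  by_cases hxA : x ∈ A
  · exact A.mul_mem (A.mul_mem hxA hy) (A.inv_mem hxA)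
  · refine h.mul_mem _ (D.mul_mem hx (h.le hy)) _ (D.inv_mem hx) ?_ ?_
    · rwa [A.mul_mem_cancel_right hy]
    · rwa [A.inv_mem_iff]

/-- Conjugation by elements of `D` acts on the cyclic group `A` by power maps. -/
theorem conj_mem_zpowers (h : IsCyclicOfIndexLETwo A D) {x y : G} (hx : x ∈ D) (hy : y ∈ A) :
    x * y * x⁻¹ ∈ Subgroup.zpowers y := by
  obtain ⟨⟨g, hg⟩, hgen⟩ := h.isCyclic.exists_generator
  have key : ∀ z ∈ A, ∃ k : ℤ, g ^ k = z := fun z hz => by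
    obtain ⟨k, hk⟩ := hgen ⟨z, hz⟩
    exact ⟨k, congrArg Subtype.val hk⟩
  obtain ⟨k, rfl⟩ := key y hy
  obtain ⟨m, hm⟩ := key _ (h.conj_mem hx hg)
  refine ⟨m, ?_⟩
  change (g ^ k) ^ m = x * g ^ k * x⁻¹
  rw [← conj_zpow, ← hm, ← zpow_mul, ← zpow_mul, mul_comm]

theorem isSolvable (h : IsCyclicOfIndexLETwo A (⊤ : Subgroup G)) : Group.IsSolvable G := by
  have hn : A.Normal := ⟨fun y hy x => h.conj_mem (Subgroup.mem_top x) hy⟩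
  have := h.isCyclic
  have hA : Group.IsSolvable A := Group.isSolvable_of_comm fun a b => IsCyclic.commGroup.mul_comm a b
  have hQ : Group.IsSolvable (G ⧸ A) := by
    have sq : ∀ x : G ⧸ A, x * x = 1 := by
      intro x
      obtain ⟨x, rfl⟩ := QuotientGroup.mk_surjective x
      exact (QuotientGroup.eq_one_iff _).2 (h.sq_mem (Subgroup.mem_top x))
    refine Group.isSolvable_of_comm fun x y => ?_
    have hxy := sq (x * y)
    have hinv : ∀ z : G ⧸ A, z⁻¹ = z := fun z => inv_eq_of_mul_eq_one_right (sq z)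
    rw [← hinv (x * y), mul_inv_rev, hinv, hinv]
  exact Group.isSolvable_of_ker_le_range A.subtype (QuotientGroup.mk' A) (by simp)

theorem card_le [Finite G] (h : IsCyclicOfIndexLETwo A D) : Nat.card D ≤ 2 * Nat.card A := by
  classical
  by_cases hAD : D ≤ A
  · have := Subgroup.card_le_of_le hAD
    omega
  · obtain ⟨t, htD, htA⟩ := SetLike.not_le_iff_exists.1 hAD
    have hsub : (D : Set G) ⊆ (A : Set G) ∪ (fun x => t⁻¹ * x) '' (A : Set G) := by
      intro x hx
      by_cases hxA : x ∈ A
      · exact Or.inl hxA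
      · exact Or.inr ⟨t * x, h.mul_mem t htD x hx htA hxA, by simp⟩
    have h1 := Set.ncard_le_ncard hsub (Set.toFinite _)
    have h2 := Set.ncard_union_le (A : Set G) ((fun x => t⁻¹ * x) '' (A : Set G))
    have h3 := Set.ncard_image_le (f := fun x => t⁻¹ * x) (Set.toFinite (A : Set G))
    have h4 : (A : Set G).ncard = Nat.card A := rfl
    have h5 : (D : Set G).ncard = Nat.card D := rfl
    omega

/-- In a core-free maximal subgroup, a cyclic subgroup of index at most two is a
trivial-intersection subgroup. -/
theorem mem_of_conj_mem [Finite G] {M B : Subgroup G} (h : IsCyclicOfIndexLETwo B M) (hM : IsCoatom M)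
    (hcore : M.normalCore = ⊥) {g x : G} (hx : x ∈ B) (hgx : g⁻¹ * x * g ∈ B) (hx1 : x ≠ 1) :
    g ∈ M := by
  by_contra hg
  set Z := Subgroup.zpowers x with hZ
  have conjZ : ∀ y : G, y * x * y⁻¹ ∈ Z → ∀ m ∈ Z, y * m * y⁻¹ ∈ Z := by
    rintro y hy _ ⟨k, rfl⟩
    change y * x ^ k * y⁻¹ ∈ Z
    rw [← conj_zpow]
    exact Z.zpow_mem hy k
  have hMN : ∀ m ∈ M, ∀ z ∈ Z, m * z * m⁻¹ ∈ Z := fun m hm =>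
    conjZ m (h.conj_mem_zpowers hm hx)
  have hgMN : ∀ m ∈ M, ∀ z ∈ Z, (g * m * g⁻¹) * z * (g * m * g⁻¹)⁻¹ ∈ Z := by
    intro m hm
    apply conjZ
    obtain ⟨k, hk⟩ := h.conj_mem_zpowers hm hgx
    refine ⟨k, ?_⟩
    have hk' : (g⁻¹ * x * g) ^ k = m * (g⁻¹ * x * g) * m⁻¹ := hk
    have : (g⁻¹ * x * g) ^ k = g⁻¹ * x ^ k * g := by
      simpa using conj_zpow (a := g⁻¹) (b := x) (i := k)
    change x ^ k = _
    rw [this] at hk'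
    calc x ^ k = g * (g⁻¹ * x ^ k * g) * g⁻¹ := by group
      _ = _ := by rw [hk']; group
  have normalizer_of : ∀ y : G, (∀ z ∈ Z, y * z * y⁻¹ ∈ Z) → (∀ z ∈ Z, y⁻¹ * z * y⁻¹⁻¹ ∈ Z) →
      y ∈ Subgroup.normalizer (Z : Set G) := by
    intro y h1 h2
    rw [Subgroup.mem_normalizer_iff]
    intro z
    refine ⟨h1 z, fun hz => ?_⟩
    have := h2 _ hz
    simpa [mul_assoc] using this
  have hle : M ≤ Subgroup.normalizer (Z : Set G) := fun m hm =>
    normalizer_of m (hMN m hm) (hMN _ (M.inv_mem hm))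
  have core_bot : ∀ K : Subgroup G, K.Normal → K ≤ M → K = ⊥ := fun K hK hKM =>
    le_bot_iff.1 (hcore ▸ Subgroup.normal_le_normalCore.2 hKM)
  have hne : Subgroup.normalizer (Z : Set G) ≠ ⊤ := by
    intro htop
    have := core_bot Z (Subgroup.normalizer_eq_top_iff.1 htop)
      ((Subgroup.zpowers_le).2 (h.le hx))
    exact hx1 (Subgroup.zpowers_eq_bot.1 this)
  have hNM : Subgroup.normalizer (Z : Set G) = M := (hM.le_iff.1 hle).resolve_left hne
  have hgM : ∀ m ∈ M, g * m * g⁻¹ ∈ M := by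
    intro m hm
    rw [← hNM]
    refine normalizer_of _ (hgMN m hm) ?_
    have := hgMN _ (M.inv_mem hm)
    simpa [mul_assoc] using this
  have htop : Subgroup.normalizer (M : Set G) = ⊤ := by
    refine hM.2 _ (lt_of_le_of_ne Subgroup.le_normalizer fun he => hg ?_)
    rw [he]
    exact Subgroup.mem_normalizer_fintype hgM
  have hMbot := core_bot M (Subgroup.normalizer_eq_top_iff.1 htop) le_rfl
  have hxM := h.le hx
  rw [hMbot] at hxM
  exact hx1 hxM

/-- A cyclic subgroup of index at most two in a core-free maximal subgroup `M` meets some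
conjugate of `M` trivially. -/
theorem exists_conj_inf_eq_bot [Finite G] {M B : Subgroup G} (h : IsCyclicOfIndexLETwo B M)
    (hM : IsCoatom M) (hcore : M.normalCore = ⊥) :
    ∃ g : G, ∀ x ∈ B, g⁻¹ * x * g ∈ M → x = 1 := by
  classical
  have := Fintype.ofFinite B
  by_contra! hno
  obtain ⟨g₀, -, hg₀⟩ := SetLike.exists_of_lt hM.lt_top
  -- nontrivial elements of `B` in another conjugate of `M` are involutions
  have hinv : ∀ g ∉ M, ∀ x ∈ B, g⁻¹ * x * g ∈ M → x * x = 1 := by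
    intro g hg x hx hgx
    by_contra hne
    refine hg (h.mem_of_conj_mem hM hcore (B.mul_mem hx hx) ?_ hne)
    have := h.sq_mem hgx
    simpa [mul_assoc] using this
  obtain ⟨z, hzB, hzM, hz1⟩ := hno g₀
  have hz2 := hinv g₀ hg₀ z hzB hzM
  have := h.isCyclic
  have hz : z ∈ M.normalCore := by
    intro g
    by_cases hg : g ∈ M
    · exact M.mul_mem (M.mul_mem hg (h.le hzB)) (M.inv_mem hg)
    · have hg' : g⁻¹ ∉ M := by rwa [M.inv_mem_iff]
      obtain ⟨y, hyB, hyM, hy1⟩ := hno g⁻¹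
      have hy2 := hinv g⁻¹ hg' y hyB hyM
      have hyz : y = z := by
        by_contra hne
        have hcard := IsCyclic.card_pow_eq_one_le (α := B) (n := 2) two_pos
        have h3 : ({1, ⟨y, hyB⟩, ⟨z, hzB⟩} : Finset B).card = 3 := by
          refine Finset.card_eq_three.2 ⟨_, _, _, ?_, ?_, ?_, rfl⟩
          · exact fun he => hy1 (congrArg Subtype.val he).symm
          · exact fun he => hz1 (congrArg Subtype.val he).symm
          · exact fun he => hne (congrArg Subtype.val he)
        have hsub : ({1, ⟨y, hyB⟩, ⟨z, hzB⟩} : Finset B) ⊆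
            Finset.univ.filter fun x : B => x ^ 2 = 1 := by
          intro x hx
          simp only [Finset.mem_insert, Finset.mem_singleton] at hx
          rw [Finset.mem_filter, sq]
          refine ⟨Finset.mem_univ _, ?_⟩
          rcases hx with rfl | rfl | rfl
          · exact mul_one 1
          · exact Subtype.ext hy2
          · exact Subtype.ext hz2
        have := Finset.card_le_card hsub
        omega
      subst hyz
      simpa using hyM
  rw [hcore] at hz
  exact hz1 hz

theorem card_mul_card_lt [Finite G] {M B : Subgroup G} (h : IsCyclicOfIndexLETwo B M)
    (hM : IsCoatom M) (hcore : M.normalCore = ⊥) (hB : B ≠ ⊥) :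
    Nat.card B * Nat.card M < Nat.card G := by
  obtain ⟨g, hg⟩ := h.exists_conj_inf_eq_bot hM hcore
  let f : B × M → G := fun p => p.1 * g * p.2
  have hf : Function.Injective f := by
    rintro ⟨⟨b, hb⟩, ⟨m, hm⟩⟩ ⟨⟨b', hb'⟩, ⟨m', hm'⟩⟩ he
    have he' : b * g * m = b' * g * m' := he
    have h1 : b'⁻¹ * b = 1 := by
      apply hg _ (B.mul_mem (B.inv_mem hb') hb)
      have : g⁻¹ * (b'⁻¹ * b) * g = m' * m⁻¹ := by
        calc g⁻¹ * (b'⁻¹ * b) * g = g⁻¹ * b'⁻¹ * (b * g * m) * m⁻¹ := by group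
          _ = m' * m⁻¹ := by rw [he']; group
      rw [this]
      exact M.mul_mem hm' (M.inv_mem hm)
    have h2 : b = b' := (inv_mul_eq_one.1 h1).symm
    subst h2
    have h3 : m = m' := mul_left_cancel he'
    subst h3
    rfl
  have hns : ¬ Function.Surjective f := by
    intro hs
    obtain ⟨⟨⟨b, hb⟩, ⟨m, hm⟩⟩, he⟩ := hs 1
    have he' : b * g * m = 1 := he
    have hgM : g ∈ M := by
      have : g = b⁻¹ * (b * g * m) * m⁻¹ := by group
      rw [this, he', mul_one]
      exact M.mul_mem (M.inv_mem (h.le hb)) (M.inv_mem hm)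
    refine hB ((Subgroup.eq_bot_iff_forall _).2 fun x hx => hg x hx ?_)
    exact M.mul_mem (M.mul_mem (M.inv_mem hgM) (h.le hx)) hgM
  rw [← Nat.card_prod]
  have := Fintype.ofFinite B
  have := Fintype.ofFinite M
  have := Fintype.ofFinite G
  rw [Nat.card_eq_fintype_card, Nat.card_eq_fintype_card]
  exact Fintype.card_lt_of_injective_not_surjective f hf hns

end IsCyclicOfIndexLETwo

/-- A complement `D` of a self-normalizing trivial-intersection subgroup `C` is normal. -/
theorem Subgroup.normal_of_mul_of_conj_disjoint {G : Type*} [Group G] [Finite G]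
    {D C : Subgroup G} (hfact : ∀ x : G, ∃ d ∈ D, ∃ c ∈ C, x = d * c)
    (hDC : ∀ x ∈ D, x ∈ C → x = 1)
    (hC : ∀ g x : G, x ∈ C → g⁻¹ * x * g ∈ C → x ≠ 1 → g ∈ C) : D.Normal := by
  classical
  let R : Set G := {x | ∃ g : G, g⁻¹ * x * g ∈ C ∧ x ≠ 1}
  let f : (G ⧸ C) × {c : C // c ≠ 1} → R := fun p =>
    ⟨p.1.out * (p.2.1 : G) * p.1.out⁻¹, p.1.out, by simp [mul_assoc], by
      intro h
      have h1 : (p.2.1 : G) = 1 := by simpa using h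
      exact p.2.2 (Subtype.ext h1)⟩
  have hf : Function.Injective f := by
    rintro ⟨q, ⟨⟨c, hc⟩, hc1⟩⟩ ⟨q', ⟨⟨c', hc'⟩, hc1'⟩⟩ he
    have he' : q.out * c * q.out⁻¹ = q'.out * c' * q'.out⁻¹ := congrArg Subtype.val he
    have hcc : (q.out⁻¹ * q'.out)⁻¹ * c * (q.out⁻¹ * q'.out) = c' := by
      calc _ = q'.out⁻¹ * (q.out * c * q.out⁻¹) * q'.out := by group
        _ = c' := by rw [he']; group
    have hmem := hC (q.out⁻¹ * q'.out) c hc (by rwa [hcc])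
      (fun h => hc1 (Subtype.ext h))
    have hq : q = q' := by
      rw [← q.out_eq', ← q'.out_eq']
      exact QuotientGroup.eq.2 hmem
    subst hq
    have : c = c' := by simpa using he'
    subst this
    rfl
  have hRD : R ⊆ (D : Set G)ᶜ := by
    rintro x ⟨g, hg, hx1⟩ hxD
    obtain ⟨d, hd, c, hc, rfl⟩ := hfact g
    have h1 : d⁻¹ * x * d ∈ C := by
      have := C.mul_mem (C.mul_mem hc hg) (C.inv_mem hc)
      simpa [mul_assoc] using this
    have h2 := hDC _ (D.mul_mem (D.mul_mem (D.inv_mem hd) hxD) hd) h1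
    apply hx1
    calc x = d * (d⁻¹ * x * d) * d⁻¹ := by group
      _ = 1 := by rw [h2]; group
  have hcardR : Nat.card ((G ⧸ C) × {c : C // c ≠ 1}) ≤ R.ncard :=
    Nat.card_le_card_of_injective f hf
  have hGle : Nat.card G ≤ Nat.card D * Nat.card C := by
    rw [← Nat.card_prod]
    refine Nat.card_le_card_of_surjective (fun p : D × C => (p.1 : G) * p.2) fun x => ?_
    obtain ⟨d, hd, c, hc, rfl⟩ := hfact x
    exact ⟨(⟨d, hd⟩, ⟨c, hc⟩), rfl⟩
  have hGC : Nat.card G = Nat.card (G ⧸ C) * Nat.card C := Subgroup.card_eq_card_quotient_mul_card_subgroup C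
  have hC1 : Nat.card {c : C // c ≠ 1} + 1 = Nat.card C := by
    have := Set.ncard_add_ncard_compl ({1} : Set C)
    rw [Set.ncard_singleton, add_comm] at this
    exact this
  have hcompl : (D : Set G).ncard + (D : Set G)ᶜ.ncard = Nat.card G := Set.ncard_add_ncard_compl _
  have hDcard : (D : Set G).ncard = Nat.card D := rfl
  have hle : (D : Set G)ᶜ.ncard ≤ R.ncard := by
    have hpos : 0 < Nat.card C := Nat.card_pos
    rw [Nat.card_prod] at hcardR
    have hq : Nat.card (G ⧸ C) ≤ Nat.card D := by
      rw [hGC] at hGle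
      exact Nat.le_of_mul_le_mul_right hGle hpos
    rw [← hC1] at hGC
    rw [mul_add] at hGC
    omega
  have hEq : R = (D : Set G)ᶜ := Set.eq_of_subset_of_ncard_le hRD hle
  refine ⟨fun n hn g => ?_⟩
  by_contra hne
  have hR : g * n * g⁻¹ ∈ R := by rw [hEq]; exact hne
  obtain ⟨k, hk, hk1⟩ := hR
  have : n ∈ R := by
    refine ⟨g⁻¹ * k, by simpa [mul_assoc] using hk, fun h => hk1 (by simp [h])⟩
  exact hRD this hn

/-- A finite product of a group with a cyclic subgroup of index at most two and a cyclic group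
is solvable. -/
theorem IsCyclicOfIndexLETwo.isSolvable_of_mul {G : Type*} [Group G] [Finite G]
    {A D C : Subgroup G} (hD : IsCyclicOfIndexLETwo A D) (hC : IsCyclic C)
    (hfact : ∀ x : G, ∃ d ∈ D, ∃ c ∈ C, x = d * c) : Group.IsSolvable G := by
  induction hN : Nat.card G using Nat.strong_induction_on generalizing G with
  | _ N ih =>
  subst hN
  by_contra hns
  -- proper subgroups containing `D` or `C` are solvable
  have hsub : ∀ M : Subgroup G, M ≠ ⊤ → (∀ x : M, ∃ d ∈ D, ∃ c ∈ C, d ∈ M ∧ c ∈ M ∧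
      (x : G) = d * c) → Group.IsSolvable M := by
    intro M hM hMf
    have hlt : Nat.card M < Nat.card G := by
      refine lt_of_le_of_ne (Subgroup.card_le_card_group M) fun h => hM ?_
      exact Subgroup.eq_top_of_card_eq M h
    refine ih _ hlt (hD.subgroupOf M)
      ((IsCyclicOfIndexLETwo.of_isCyclic hC).subgroupOf M).isCyclic ?_ rfl
    intro x
    obtain ⟨d, hd, c, hc, hdM, hcM, hx⟩ := hMf x
    exact ⟨⟨d, hdM⟩, hd, ⟨c, hcM⟩, hc, Subtype.ext hx⟩
  have hF : ∀ K : Subgroup G, K.Normal → Group.IsSolvable K → K = ⊥ := by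
    intro K hK hKs
    by_contra hKne
    apply hns
    have hlt : Nat.card (G ⧸ K) < Nat.card G := by
      have h1 := Subgroup.card_eq_card_quotient_mul_card_subgroup K
      have h2 : 1 < Nat.card K := (Subgroup.one_lt_card_iff_ne_bot K).2 hKne
      have h3 : 0 < Nat.card (G ⧸ K) := Nat.card_pos
      rw [h1]
      nlinarith
    have hq : Group.IsSolvable (G ⧸ K) := by
      refine ih _ hlt (hD.map (QuotientGroup.mk' K))
        ((IsCyclicOfIndexLETwo.of_isCyclic hC).map (QuotientGroup.mk' K)).isCyclic ?_ rfl
      intro x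
      obtain ⟨x, rfl⟩ := QuotientGroup.mk_surjective x
      obtain ⟨d, hd, c, hc, rfl⟩ := hfact x
      exact ⟨_, Subgroup.mem_map_of_mem _ hd, _, Subgroup.mem_map_of_mem _ hc, rfl⟩
    exact Group.isSolvable_of_ker_le_range K.subtype (QuotientGroup.mk' K) (by simp)
  have hcoreF : ∀ M : Subgroup G, Group.IsSolvable M → M.normalCore = ⊥ := fun M hM =>
    hF _ inferInstance
      (Group.isSolvable_of_isSolvable_injective (Subgroup.inclusion_injective M.normalCore_le))
  have hDtop : D ≠ ⊤ := by
    rintro rfl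
    exact hns hD.isSolvable
  have hCtop : C ≠ ⊤ := by
    rintro rfl
    exact hns (IsCyclicOfIndexLETwo.of_isCyclic hC).isSolvable
  have hCbot : C ≠ ⊥ := by
    rintro rfl
    refine hDtop ((Subgroup.eq_top_iff' _).2 fun x => ?_)
    obtain ⟨d, hd, c, hc, rfl⟩ := hfact x
    rw [Subgroup.mem_bot] at hc
    simpa [hc] using hd
  -- `D` is a core-free maximal subgroup meeting `C` trivially
  obtain ⟨L, hL, hDL⟩ := (eq_top_or_exists_le_coatom D).resolve_left hDtop
  have hLf : ∀ x : L, ∃ d ∈ D, ∃ c ∈ C, d ∈ L ∧ c ∈ L ∧ (x : G) = d * c := by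
    rintro ⟨x, hx⟩
    obtain ⟨d, hd, c, hc, rfl⟩ := hfact x
    exact ⟨d, hd, c, hc, hDL hd, (L.mul_mem_cancel_left (hDL hd)).1 hx, rfl⟩
  have hLcore := hcoreF L (hsub L hL.1 hLf)
  have hLC : ∀ x ∈ L, x ∈ C → x = 1 := by
    intro c hcL hcC
    have : c ∈ L.normalCore := by
      intro x
      obtain ⟨d, hd, c', hc', rfl⟩ := hfact x
      have hcomm : c' * c = c * c' := congrArg Subtype.val
        (IsCyclic.commGroup.mul_comm (⟨c', hc'⟩ : C) ⟨c, hcC⟩)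
      have : d * c' * c * (d * c')⁻¹ = d * c * d⁻¹ := by
        rw [mul_assoc d, hcomm]; group
      rw [this]
      exact L.mul_mem (L.mul_mem (hDL hd) hcL) (L.inv_mem (hDL hd))
    rwa [hLcore] at this
  have hLD : L = D := by
    refine le_antisymm (fun x hx => ?_) hDL
    obtain ⟨d, hd, c, hc, -, hcL, hxe⟩ := hLf ⟨x, hx⟩
    have hxe' : x = d * c := hxe
    rw [hxe', hLC c hcL hc, mul_one]
    exact hd
  subst hLD
  -- a maximal subgroup containing `C` meets `A` trivially
  obtain ⟨M, hM, hCM⟩ := (eq_top_or_exists_le_coatom C).resolve_left hCtop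
  have hMf : ∀ x : M, ∃ d ∈ L, ∃ c ∈ C, d ∈ M ∧ c ∈ M ∧ (x : G) = d * c := by
    rintro ⟨x, hx⟩
    obtain ⟨d, hd, c, hc, rfl⟩ := hfact x
    exact ⟨d, hd, c, hc, (M.mul_mem_cancel_right (hCM hc)).1 hx, hCM hc, rfl⟩
  have hMcore := hcoreF M (hsub M hM.1 hMf)
  have hMA : ∀ x ∈ M, x ∈ A → x = 1 := by
    intro a haM haA
    have : a ∈ M.normalCore := by
      intro x
      obtain ⟨d, hd, c, hc, hx⟩ := hfact x⁻¹
      have hx' : x = c⁻¹ * d⁻¹ := by rw [← inv_inv x, hx, mul_inv_rev]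
      have h1 := (Subgroup.zpowers_le.2 haM) (hD.conj_mem_zpowers (L.inv_mem hd) haA)
      have h2 := M.mul_mem (M.mul_mem (M.inv_mem (hCM hc)) h1) (hCM hc)
      rw [hx']
      simpa [mul_assoc] using h2
    rwa [hMcore] at this
  have hMC : IsCyclicOfIndexLETwo C M := by
    refine ⟨hCM, hC, fun x hx y hy hxC hyC => ?_⟩
    obtain ⟨d, hd, c, hc, hdM, -, hx'⟩ := hMf ⟨x⁻¹, M.inv_mem hx⟩
    obtain ⟨e, he, c', hc', heM, -, hy'⟩ := hMf ⟨y, hy⟩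
    have hx'' : x⁻¹ = d * c := hx'
    have hy'' : y = e * c' := hy'
    have hdA : d ∉ A := by
      intro h
      rw [hMA d hdM h, one_mul] at hx''
      exact hxC (C.inv_mem_iff.1 (hx'' ▸ hc))
    have heA : e ∉ A := by
      intro h
      rw [hMA e heM h, one_mul] at hy''
      exact hyC (hy'' ▸ hc')
    have hde : d⁻¹ * e = 1 := hMA _ (M.mul_mem (M.inv_mem hdM) heM)
      (hD.mul_mem _ (L.inv_mem hd) _ he (by rwa [A.inv_mem_iff]) heA)
    have : x * y = c⁻¹ * c' := by
      rw [← inv_inv x, hx'', hy'']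
      calc (d * c)⁻¹ * (e * c') = c⁻¹ * (d⁻¹ * e) * c' := by group
        _ = _ := by rw [hde, mul_one]
    rw [this]
    exact C.mul_mem (C.inv_mem hc) hc'
  by_cases hMeq : M = C
  · subst hMeq
    have hn : L.Normal := Subgroup.normal_of_mul_of_conj_disjoint hfact hLC
      fun g x hx hgx hx1 => hMC.mem_of_conj_mem hM hMcore hx hgx hx1
    have hLbot : L = ⊥ := by
      rw [← hLcore]
      exact (Subgroup.normalCore_eq_self L).symm
    refine hCtop ((Subgroup.eq_top_iff' _).2 fun x => ?_)
    obtain ⟨d, hd, c, hc, rfl⟩ := hfact x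
    rw [hLbot, Subgroup.mem_bot] at hd
    simpa [hd] using hc
  · have hGle : Nat.card G ≤ Nat.card L * Nat.card C := by
      rw [← Nat.card_prod]
      refine Nat.card_le_card_of_surjective (fun p : L × C => (p.1 : G) * p.2) fun x => ?_
      obtain ⟨d, hd, c, hc, rfl⟩ := hfact x
      exact ⟨(⟨d, hd⟩, ⟨c, hc⟩), rfl⟩
    have hM2 : 2 * Nat.card C ≤ Nat.card M := by
      obtain ⟨k, hk⟩ := Subgroup.card_dvd_of_le hCM
      have hMpos : 0 < Nat.card M := Nat.card_pos
      have hk1 : k ≠ 1 := by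
        rintro rfl
        exact hMeq (Subgroup.eq_of_le_of_card_ge hCM (by omega)).symm
      have hk0 : k ≠ 0 := by
        rintro rfl
        omega
      rw [hk, mul_comm]
      exact Nat.mul_le_mul_left _ (by omega)
    have h1 := hMC.card_mul_card_lt hM hMcore hCbot
    have h2 := hD.card_le
    have hCpos : 0 < Nat.card C := Nat.card_pos
    have hLpos : 0 < Nat.card L := Nat.card_pos
    have hCA : Nat.card C < Nat.card A := by
      have h3 : Nat.card C * (2 * Nat.card C) < 2 * Nat.card A * Nat.card C :=
        calc _ ≤ Nat.card C * Nat.card M := Nat.mul_le_mul_left _ hM2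
          _ < Nat.card G := h1
          _ ≤ _ := hGle.trans (Nat.mul_le_mul_right _ h2)
      nlinarith
    have hAbot : A ≠ ⊥ := by
      rintro rfl
      rw [Subgroup.card_bot] at hCA
      omega
    have h4 := hD.card_mul_card_lt hL hLcore hAbot
    nlinarith

/-- The product of a generalized quaternion group and a cyclic group intersecting
trivially is solvable. -/
theorem solvable_of_quaternion_mul_cyclic {X : Type*} [Group X] [Finite X]
    (Q C : Subgroup X) (n : ℕ) (hn : 2 ≤ n)
    (a b : X) (hQgen : Q = Subgroup.closure {a, b})
    (hoa : orderOf a = 2 * n) (hb2 : b ^ 2 = a ^ n)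
    (hrel : b * a * b⁻¹ = a⁻¹)
    (hcardQ : Nat.card Q = 4 * n)
    (hC : IsCyclic C)
    (hint : Q ⊓ C = ⊥)
    (hfact : ∀ x : X, ∃ g ∈ Q, ∃ c ∈ C, x = g * c) :
    IsSolvable X := by
  have hle : Subgroup.zpowers a ≤ Q := by
    rw [Subgroup.zpowers_le, hQgen]
    exact Subgroup.subset_closure (by simp)
  have hidx : ((Subgroup.zpowers a).subgroupOf Q).index = 2 := by
    have h1 := ((Subgroup.zpowers a).subgroupOf Q).card_mul_index
    rw [Nat.card_congr (Subgroup.subgroupOfEquivOfLe hle).toEquiv, Nat.card_zpowers, hoa,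
      hcardQ] at h1
    have h2 : 0 < 2 * n := by omega
    exact Nat.eq_of_mul_eq_mul_left h2 (by omega)
  refine IsCyclicOfIndexLETwo.isSolvable_of_mul (A := Subgroup.zpowers a) (D := Q)
    ⟨hle, inferInstance, fun x hx y hy hxA hyA => ?_⟩ hC hfact
  have := Subgroup.mul_mem_iff_of_index_two hidx (a := ⟨x, hx⟩) (b := ⟨y, hy⟩)
  simp only [Subgroup.mem_subgroupOf] at this
  exact this.2 (by simp [hxA, hyA])
end

section
/- Let X = Q⟨c⟩ be a finite group where Q = ⟨a,b⟩ is a generalized quaternion group of order 4n (n ≥ 2), ⟨c⟩ is cyclic with Q ∩ ⟨c⟩ = 1, and suppose the core of ⟨c⟩ in X is trivial. Then the core of ⟨a⟩ in X is nontrivial; that is, there is a nontrivial subgroup of ⟨a⟩ normal in X. -/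
theorem Subgroup.exists_mem_normalizer_notMem {G : Type*} [Group G] [Finite G] {K : Set G}
    {D P : Subgroup G} (hP : Group.IsNilpotent P) (hDP : D ≤ P)
    (hD : D = Subgroup.closure (K ∩ D)) (hK : ∀ x ∈ K, ∀ g : G, g * x * g⁻¹ ∈ K)
    (hne : ∃ x ∈ K, x ∈ P ∧ x ∉ D) :
    ∃ x ∈ K, x ∈ P ∧ x ∉ D ∧ x ∈ Subgroup.normalizer (D : Set G) := by
  obtain ⟨U, ⟨hDU, hUP, hUK⟩, hmax⟩ := (Set.toFinite
    {U : Subgroup G | D ≤ U ∧ U ≤ P ∧ ∀ x ∈ K, x ∈ U → x ∈ D}).exists_maximal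
    ⟨D, le_rfl, hDP, fun _ _ h => h⟩
  have hlt : U.subgroupOf P < ⊤ := by
    rw [lt_top_iff_ne_top, Ne, Subgroup.subgroupOf_eq_top]
    obtain ⟨x, hxK, hxP, hxD⟩ := hne
    exact fun h => hxD (hUK x hxK (h hxP))
  obtain ⟨⟨g, hgP⟩, hgN, hgU⟩ :=
    SetLike.exists_of_lt (Group.normalizerCondition_of_isNilpotent (G := P) _ hlt)
  rw [Subgroup.mem_subgroupOf] at hgU
  have hgN' : g ∈ Subgroup.normalizer (U : Set G) := by
    rw [Subgroup.mem_normalizer_iff] at hgN ⊢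
    intro h
    constructor
    · intro hh
      exact (hgN ⟨h, hUP hh⟩).1 hh
    · intro hh
      have h1 : h ∈ P := by
        have := P.mul_mem (P.mul_mem (P.inv_mem hgP) (hUP hh)) hgP
        simpa [mul_assoc] using this
      exact (hgN ⟨h, h1⟩).2 hh
  have hVN : U ⊔ Subgroup.zpowers g ≤ Subgroup.normalizer (U : Set G) :=
    sup_le Subgroup.le_normalizer (by simpa using hgN')
  have hVP : U ⊔ Subgroup.zpowers g ≤ P := sup_le hUP (by simpa using hgP)
  have hgV : g ∈ U ⊔ Subgroup.zpowers g :=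
    (le_sup_right : _ ≤ U ⊔ _) (Subgroup.mem_zpowers g)
  have : ∃ x ∈ K, x ∈ U ⊔ Subgroup.zpowers g ∧ x ∉ D := by
    by_contra! hcon
    exact hgU (hmax ⟨hDU.trans le_sup_left, hVP, hcon⟩ le_sup_left hgV)
  obtain ⟨x, hxK, hxV, hxD⟩ := this
  refine ⟨x, hxK, hVP hxV, hxD, ?_⟩
  have hxN := Subgroup.mem_normalizer_iff.1 (hVN hxV)
  have key : ∀ g : G, (∀ h, h ∈ U → g * h * g⁻¹ ∈ U) → ∀ d ∈ D, g * d * g⁻¹ ∈ D := by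
    intro g hg
    have : D ≤ D.comap (MulAut.conj g).toMonoidHom := by
      conv_lhs => rw [hD]
      rw [Subgroup.closure_le]
      rintro d ⟨hdK, hdD⟩
      exact hUK _ (hK d hdK g) (hg d (hDU hdD))
    exact fun d hd => this hd
  rw [Subgroup.mem_normalizer_iff]
  intro d
  refine ⟨key x (fun h hh => (hxN h).1 hh) d, fun hd => ?_⟩
  have := key x⁻¹ (fun h hh => (hxN _).2 (by simpa [mul_assoc] using hh)) _ hd
  simpa [mul_assoc] using this

open scoped Pointwise in
/-- The Baer–Suzuki theorem. -/
theorem IsPGroup.normalClosure_of_forall_closure_pair {G : Type*} [Group G] [Finite G] {p : ℕ}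
    [Fact p.Prime] {x : G}
    (h : ∀ g : G, IsPGroup p (Subgroup.closure {x, g * x * g⁻¹})) :
    IsPGroup p (Subgroup.normalClosure {x}) := by
  set K : Set G := {y | ∃ g : G, g * x * g⁻¹ = y} with hKdef
  have hK : ∀ y ∈ K, ∀ g : G, g * y * g⁻¹ ∈ K := by
    rintro _ ⟨k, rfl⟩ g
    exact ⟨g * k, by group⟩
  have hpair : ∀ u ∈ K, ∀ v ∈ K, IsPGroup p (Subgroup.closure {u, v}) := by
    rintro _ ⟨k, rfl⟩ _ ⟨l, rfl⟩
    have := (h (k⁻¹ * l)).map (MulAut.conj k).toMonoidHom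
    rw [MonoidHom.map_closure] at this
    refine this.to_le (Subgroup.closure_mono ?_)
    rintro y (rfl | rfl)
    · exact ⟨x, by simp, rfl⟩
    · exact ⟨k⁻¹ * l * x * (k⁻¹ * l)⁻¹, by simp, by simp [mul_assoc]⟩
  by_cases hall : ∀ P R : Sylow p G, ∀ y ∈ K, y ∈ P → y ∈ R
  · obtain ⟨P, hP⟩ := (h 1).exists_le_sylow
    have hxP : x ∈ P := hP (Subgroup.subset_closure (by simp))
    refine P.isPGroup'.to_le ?_
    rw [Subgroup.normalClosure, Subgroup.closure_le]
    intro y hy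
    obtain ⟨g, hg⟩ : y ∈ K := by
      obtain ⟨z, hz, hc⟩ := Group.mem_conjugatesOfSet_iff.1 hy
      obtain rfl : z = x := hz
      exact isConj_iff.1 hc
    have : y ∈ MulAut.conj g • (P : Subgroup G) :=
      Subgroup.mem_smul_pointwise_iff_exists _ _ _ |>.2 ⟨x, hxP, hg⟩
    exact hall (MulAut.conj g • P) P y ⟨g, hg⟩ this
  exfalso
  push Not at hall
  obtain ⟨P₀, R₀, y₀, hy₀K, hy₀P, hy₀R⟩ := hall
  have hcard : ∀ P R : Sylow p G, (K ∩ P).ncard = (K ∩ R).ncard := by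
    intro P R
    obtain ⟨g, rfl⟩ := MulAction.exists_smul_eq G P R
    refine Set.ncard_congr (fun y _ => g * y * g⁻¹) ?_ ?_ ?_
    · rintro y ⟨hyK, hyP⟩
      exact ⟨hK y hyK g, Subgroup.mem_smul_pointwise_iff_exists _ _ _ |>.2 ⟨y, hyP, rfl⟩⟩
    · intro y z _ _ hyz
      simpa using hyz
    · rintro y ⟨hyK, hyP⟩
      obtain ⟨z, hz, rfl⟩ := Subgroup.mem_smul_pointwise_iff_exists _ _ _ |>.1 hyP
      refine ⟨z, ⟨?_, hz⟩, rfl⟩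
      simpa [mul_assoc] using hK _ hyK g⁻¹
  obtain ⟨⟨P, R⟩, hPR, hmax⟩ := (Set.toFinite
    {S : Sylow p G × Sylow p G | ∃ y ∈ K, y ∈ S.1 ∧ y ∉ S.2}).exists_maximalFor
    (fun S => (K ∩ (S.1 ∩ S.2 : Set G)).ncard) _ ⟨(P₀, R₀), y₀, hy₀K, hy₀P, hy₀R⟩
  have hRP : ∃ y ∈ K, y ∈ R ∧ y ∉ P := by
    by_contra! hcon
    obtain ⟨y, hyK, hyP, hyR⟩ := hPR
    have : K ∩ R = K ∩ P := Set.eq_of_subset_of_ncard_le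
      (fun z hz => ⟨hz.1, hcon z hz.1 hz.2⟩) (hcard P R).le
    exact hyR (this.symm.subset ⟨hyK, hyP⟩).2
  set D : Subgroup G := Subgroup.closure (K ∩ (P ∩ R : Set G)) with hD
  have hDP : D ≤ P := (Subgroup.closure_le _).2 fun z hz => hz.2.1
  have hDR : D ≤ R := (Subgroup.closure_le _).2 fun z hz => hz.2.2
  have hDD : D = Subgroup.closure (K ∩ D) := by
    refine le_antisymm (Subgroup.closure_mono fun z hz => ⟨hz.1, Subgroup.subset_closure hz⟩) ?_
    exact (Subgroup.closure_le _).2 fun z hz => hz.2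
  obtain ⟨u, huK, huP, huD, huN⟩ := Subgroup.exists_mem_normalizer_notMem
    P.isPGroup'.isNilpotent hDP hDD hK (by
      obtain ⟨y, hyK, hyP, hyR⟩ := hPR
      exact ⟨y, hyK, hyP, fun hy => hyR (hDR hy)⟩)
  obtain ⟨v, hvK, hvR, hvD, hvN⟩ := Subgroup.exists_mem_normalizer_notMem
    R.isPGroup'.isNilpotent hDR hDD hK (by
      obtain ⟨y, hyK, hyR, hyP⟩ := hRP
      exact ⟨y, hyK, hyR, fun hy => hyP (hDP hy)⟩)
  have hle : Subgroup.closure {u, v} ≤ Subgroup.normalizer (D : Set G) := by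
    rw [Subgroup.closure_le]
    rintro z (rfl | rfl) <;> assumption
  obtain ⟨S, hS⟩ := ((P.isPGroup'.to_le hDP).to_sup_of_normal_left'
    (hpair u huK v hvK) hle).exists_le_sylow
  have hDS : D ≤ S := le_sup_left.trans hS
  have huS : u ∈ S := hS ((le_sup_right : _ ≤ D ⊔ _) (Subgroup.subset_closure (by simp)))
  have hvS : v ∈ S := hS ((le_sup_right : _ ≤ D ⊔ _) (Subgroup.subset_closure (by simp)))
  have hbig : ∀ T : Sylow p G, D ≤ T → (∃ w ∈ K, w ∈ T ∧ w ∈ S ∧ w ∉ D) →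
      ∀ y ∈ K, y ∈ T → y ∈ S := by
    intro T hDT ⟨w, hwK, hwT, hwS, hwD⟩
    by_contra! hcon
    have h1 := hmax (show (T, S) ∈ _ from hcon)
    have h2 : (K ∩ (P ∩ R : Set G)).ncard < (K ∩ (T ∩ S : Set G)).ncard := by
      refine Set.ncard_lt_ncard ⟨fun z hz => ⟨hz.1, hDT (Subgroup.subset_closure hz),
        hDS (Subgroup.subset_closure hz)⟩, fun hsub => ?_⟩
      exact hwD (Subgroup.subset_closure (hsub ⟨hwK, hwT, hwS⟩))
    exact absurd (h1 h2.le) (not_le.2 h2)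
  have hPS := hbig P hDP ⟨u, huK, huP, huS, huD⟩
  have hRS := hbig R hDR ⟨v, hvK, hvR, hvS, hvD⟩
  have e1 : K ∩ P = K ∩ S := Set.eq_of_subset_of_ncard_le
    (fun z hz => ⟨hz.1, hPS z hz.1 hz.2⟩) (hcard S P).le
  have e2 : K ∩ R = K ∩ S := Set.eq_of_subset_of_ncard_le
    (fun z hz => ⟨hz.1, hRS z hz.1 hz.2⟩) (hcard S R).le
  obtain ⟨y, hyK, hyP, hyR⟩ := hPR
  have : y ∈ K ∩ R := by rw [e2, ← e1]; exact ⟨hyK, hyP⟩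
  exact hyR this.2

/-- If `A` and `B` are abelian and `A ⊓ B` is minimal among the intersections of `A` with
conjugates of `B`, then the `p`-elements of `A ⊓ B` generate normal `p`-subgroups. -/
theorem IsPGroup.normalClosure_of_mem_inf_of_minimal {p : ℕ} [Fact p.Prime] (m : ℕ) :
    ∀ {G : Type*} [Group G] [Finite G] (A B : Subgroup G), Nat.card G = m →
      (∀ x ∈ A, ∀ y ∈ A, x * y = y * x) → (∀ x ∈ B, ∀ y ∈ B, x * y = y * x) →
      (∀ g : G, (∀ y ∈ A, g⁻¹ * y * g ∈ B → y ∈ B) → ∀ y ∈ A, y ∈ B → g⁻¹ * y * g ∈ B) →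
      ∀ x ∈ A, x ∈ B → IsPGroup p (Subgroup.zpowers x) →
        IsPGroup p (Subgroup.normalClosure {x}) := by
  induction m using Nat.strong_induction_on with
  | _ m ih =>
  intro G _ _ A B hm hA hB hmin x hxA hxB hx
  refine IsPGroup.normalClosure_of_forall_closure_pair fun g => ?_
  set H : Subgroup G := A ⊔ B.map (MulAut.conj g).toMonoidHom with hH
  have hBH : ∀ y ∈ B, g * y * g⁻¹ ∈ H := fun y hy =>
    (le_sup_right : _ ≤ A ⊔ _) (Subgroup.mem_map.2 ⟨y, hy, rfl⟩)
  have hAH : A ≤ H := le_sup_left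
  by_cases hHt : H = ⊤
  · have hcen : ∀ y ∈ A, g⁻¹ * y * g ∈ B → ∀ t : G, t * y = y * t := by
      intro y hyA hyB t
      have hle : H ≤ Subgroup.centralizer {y} := by
        refine sup_le (fun a ha => ?_) ?_
        · exact Subgroup.mem_centralizer_singleton_iff.2 (hA a ha y hyA)
        · rintro _ ⟨b, hb, rfl⟩
          rw [Subgroup.mem_centralizer_singleton_iff]
          have := hB b hb _ hyB
          calc g * b * g⁻¹ * y = g * (b * (g⁻¹ * y * g)) * g⁻¹ := by group
            _ = g * ((g⁻¹ * y * g) * b) * g⁻¹ := by rw [this]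
            _ = y * (g * b * g⁻¹) := by group
      have ht : t ∈ Subgroup.centralizer {y} := hle (hHt ▸ Subgroup.mem_top t)
      exact Subgroup.mem_centralizer_singleton_iff.1 ht
    have hfix : ∀ y ∈ A, g⁻¹ * y * g ∈ B → g⁻¹ * y * g = y := by
      intro y hyA hyB
      rw [mul_assoc, ← hcen y hyA hyB g]; group
    have hxg := hmin g (fun y hyA hyB => hfix y hyA hyB ▸ hyB) x hxA hxB
    have hc := hcen x hxA hxg g
    have : g * x * g⁻¹ = x := by rw [hc]; group
    rw [this, Set.pair_eq_singleton, ← Subgroup.zpowers_eq_closure]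
    exact hx
  · have hcard : Nat.card H < m := by
      rw [← hm]
      exact lt_of_le_of_ne (Subgroup.card_le_card_group H)
        fun h => hHt ((Subgroup.card_eq_iff_eq_top H).1 h)
    have hN := ih _ hcard (A.subgroupOf H) (B.subgroupOf H) rfl
      (fun y hy z hz => Subtype.ext (hA y hy z hz)) (fun y hy z hz => Subtype.ext (hB y hy z hz))
      (fun h hh y hyA hyB => hmin h (fun z hzA hzB => hh ⟨z, hAH hzA⟩ hzA hzB) y hyA hyB)
      ⟨x, hAH hxA⟩ hxA hxB (by
        refine (hx.comap_subtype (K := H)).to_le ?_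
        rw [Subgroup.zpowers_le]
        exact Subgroup.mem_zpowers x)
    have hxg : IsPGroup p (Subgroup.zpowers (⟨g * x * g⁻¹, hBH x hxB⟩ : H)) := by
      refine ((hx.map (MulAut.conj g).toMonoidHom).comap_subtype (K := H)).to_le ?_
      rw [Subgroup.zpowers_le]
      exact Subgroup.mem_map.2 ⟨x, Subgroup.mem_zpowers x, rfl⟩
    refine ((hN.to_sup_of_normal_left hxg).map H.subtype).to_le ?_
    rw [Subgroup.closure_le]
    rintro z (rfl | rfl)
    · exact ⟨⟨z, hAH hxA⟩, (le_sup_left : _ ≤ _ ⊔ Subgroup.zpowers _)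
        (Subgroup.subset_normalClosure rfl), rfl⟩
    · exact ⟨⟨g * x * g⁻¹, hBH x hxB⟩, (le_sup_right : _ ≤ Subgroup.normalClosure _ ⊔ _)
        (Subgroup.mem_zpowers _), rfl⟩

theorem exists_normal_isPGroup_of_forall_inf_conj_ne_bot {G : Type*} [Group G] [Finite G]
    (A : Subgroup G) (hA : ∀ x ∈ A, ∀ y ∈ A, x * y = y * x)
    (h : ∀ g : G, ∃ y ∈ A, g⁻¹ * y * g ∈ A ∧ y ≠ 1) :
    ∃ p : ℕ, p.Prime ∧ ∃ P : Subgroup G, P.Normal ∧ IsPGroup p P ∧ P ≠ ⊥ := by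
  obtain ⟨g, hg⟩ := Finite.exists_min
    (fun g : G => {y | y ∈ A ∧ g⁻¹ * y * g ∈ A}.ncard)
  obtain ⟨y, hyA, hyg, hy1⟩ := h g
  obtain ⟨p, hp, hpd⟩ := Nat.exists_prime_and_dvd (n := orderOf y)
    (by rwa [Ne, orderOf_eq_one_iff])
  have := Fact.mk hp
  have hox : orderOf (y ^ (orderOf y / p)) = p :=
    orderOf_pow_orderOf_div (orderOf_pos y).ne' hpd
  set x := y ^ (orderOf y / p) with hx
  have hxA : x ∈ A := A.pow_mem hyA _
  have hxg : g⁻¹ * x * g ∈ A := by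
    have e : g⁻¹ * x * g = (g⁻¹ * y * g) ^ (orderOf y / p) := by
      have := conj_pow (a := g⁻¹) (b := y) (i := orderOf y / p)
      rw [inv_inv] at this
      exact this.symm
    rw [e]
    exact A.pow_mem hyg _
  have hB : ∀ z, z ∈ A.comap (MulAut.conj g⁻¹).toMonoidHom ↔ g⁻¹ * z * g ∈ A := by
    intro z
    simp [Subgroup.mem_comap]
  refine ⟨p, hp, Subgroup.normalClosure {x}, inferInstance, ?_, ?_⟩
  · refine IsPGroup.normalClosure_of_mem_inf_of_minimal _ A
      (A.comap (MulAut.conj g⁻¹).toMonoidHom) rfl hA ?_ ?_ x hxA ((hB x).2 hxg) ?_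
    · intro u hu v hv
      rw [hB] at hu hv
      have := hA _ hu _ hv
      have h2 : g⁻¹ * (u * v) * g = g⁻¹ * (v * u) * g := by
        calc _ = g⁻¹ * u * g * (g⁻¹ * v * g) := by group
          _ = _ := by rw [this]
          _ = _ := by group
      simpa using h2
    · intro k hk z hzA hzB
      simp only [hB] at hk hzB ⊢
      have hsub : {y | y ∈ A ∧ (k * g)⁻¹ * y * (k * g) ∈ A} ⊆ {y | y ∈ A ∧ g⁻¹ * y * g ∈ A} := by
        rintro u ⟨hu, hu'⟩
        refine ⟨hu, hk u hu ?_⟩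
        simpa [mul_assoc] using hu'
      have := Set.eq_of_subset_of_ncard_le hsub (hg (k * g))
      have h3 : z ∈ {y | y ∈ A ∧ g⁻¹ * y * g ∈ A} := ⟨hzA, hzB⟩
      rw [← this] at h3
      simpa [mul_assoc] using h3.2
    · refine IsPGroup.of_card (n := 1) ?_
      rw [Nat.card_zpowers, hox, pow_one]
  · intro hbot
    have : x ∈ Subgroup.normalClosure {x} := Subgroup.subset_normalClosure rfl
    rw [hbot, Subgroup.mem_bot] at this
    rw [this, orderOf_one] at hox
    exact hp.one_lt.ne hox

theorem Subgroup.card_mul_self_le_of_inf_conj_eq_bot {G : Type*} [Group G] [Finite G]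
    (H : Subgroup G) (g : G) (h : ∀ y ∈ H, g⁻¹ * y * g ∈ H → y = 1) :
    Nat.card H * Nat.card H ≤ Nat.card G ∧ (g ∉ H → Nat.card H * Nat.card H < Nat.card G) := by
  have hinj : Function.Injective fun z : H × H => (z.1 : G) * g * z.2 := by
    rintro ⟨⟨u, hu⟩, ⟨v, hv⟩⟩ ⟨⟨u', hu'⟩, ⟨v', hv'⟩⟩ huv
    have huv : u * g * v = u' * g * v' := huv
    have e1 : g⁻¹ * (u'⁻¹ * u) * g = v' * v⁻¹ := by
      calc _ = g⁻¹ * u'⁻¹ * (u * g * v) * v⁻¹ := by group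
        _ = g⁻¹ * u'⁻¹ * (u' * g * v') * v⁻¹ := by rw [huv]
        _ = _ := by group
    have e2 := h (u'⁻¹ * u) (H.mul_mem (H.inv_mem hu') hu)
      (e1 ▸ H.mul_mem hv' (H.inv_mem hv))
    rw [e2] at e1
    have e3 : v' * v⁻¹ = 1 := by rw [← e1]; group
    simp only [Prod.mk.injEq, Subtype.mk.injEq]
    exact ⟨(inv_mul_eq_one.1 e2).symm, (mul_inv_eq_one.1 e3).symm⟩
  rw [← Nat.card_prod]
  refine ⟨Nat.card_le_card_of_injective _ hinj, fun hg => ?_⟩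
  refine lt_of_le_of_ne (Nat.card_le_card_of_injective _ hinj) fun hcard => ?_
  obtain ⟨⟨⟨u, hu⟩, ⟨v, hv⟩⟩, huv⟩ :=
    ((Nat.bijective_iff_injective_and_card _).2 ⟨hinj, hcard⟩).2 1
  have huv : u * g * v = 1 := huv
  have : g = u⁻¹ * v⁻¹ := by
    rw [← mul_inv_rev, eq_inv_iff_mul_eq_one]
    calc g * (v * u) = u⁻¹ * (u * g * v) * u := by group
      _ = 1 := by rw [huv]; group
  exact hg (this ▸ H.mul_mem (H.inv_mem hu) (H.inv_mem hv))

theorem Subgroup.ncard_pow_eq_one_le {G : Type*} [Group G] [Finite G] {m : ℕ} (hm : 0 < m)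
    (h : G) : {z : G | z ∈ Subgroup.zpowers h ∧ z ^ m = 1}.ncard ≤ m := by
  classical
  have := Fintype.ofFinite (Subgroup.zpowers h)
  refine le_trans ?_ (IsCyclic.card_pow_eq_one_le (α := Subgroup.zpowers h) hm)
  rw [← Set.ncard_coe_finset]
  refine Set.ncard_le_ncard_of_injOn (fun z => if hz : z ∈ Subgroup.zpowers h then ⟨z, hz⟩ else 1)
    ?_ ?_
  · rintro z ⟨hz, hzp⟩
    simp only [hz, dite_true]
    simpa [Subtype.ext_iff] using hzp
  · rintro z ⟨hz, hzp⟩ w ⟨hw, hwp⟩ hzw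
    simpa [hz, hw] using hzw

/-- In a finite cyclic group, an element of prime order generates all elements of that exponent. -/
theorem Subgroup.mem_zpowers_of_pow_prime_eq_one {G : Type*} [Group G] [Finite G] {p : ℕ}
    (hp : p.Prime) {h x y : G} (hx : x ∈ Subgroup.zpowers h) (hy : y ∈ Subgroup.zpowers h)
    (hxp : x ^ p = 1) (hyp : y ^ p = 1) (hx1 : x ≠ 1) : y ∈ Subgroup.zpowers x := by
  have := Fact.mk hp
  have hox : orderOf x = p := orderOf_eq_prime hxp hx1
  have hle := Subgroup.ncard_pow_eq_one_le hp.pos h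
  have hsub : (Subgroup.zpowers x : Set G) ⊆ {z : G | z ∈ Subgroup.zpowers h ∧ z ^ p = 1} := by
    rintro z hz
    refine ⟨(Subgroup.zpowers_le.2 hx) hz, ?_⟩
    obtain ⟨k, rfl⟩ := Subgroup.mem_zpowers_iff.1 hz
    rw [← zpow_natCast, zpow_comm, zpow_natCast, hxp, one_zpow]
  have hcard : (Subgroup.zpowers x : Set G).ncard = p := by
    rw [← hox, ← Nat.card_zpowers, ← Nat.card_coe_set_eq]; rfl
  have := Set.eq_of_subset_of_ncard_le hsub (by omega)
  have h2 : y ∈ {z : G | z ∈ Subgroup.zpowers h ∧ z ^ p = 1} := ⟨hy, hyp⟩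
  rwa [← this] at h2

/-- `X = Q⟨c⟩` with `Q ∩ ⟨c⟩ = 1`, where `Q` is generated by `a` of order `2 n` and `b` with
`b ^ 2 = a ^ n` and `b a b⁻¹ = a⁻¹`. For `n = 1` the group `Q` is cyclic of order `4`. -/
structure IsDicyclicFactorization {X : Type*} [Group X] (n : ℕ) (a b c : X) (Q : Subgroup X) :
    Prop where
  pos : 0 < n
  a_mem : a ∈ Q
  b_mem : b ∈ Q
  mem_or : ∀ x ∈ Q, x ∈ Subgroup.zpowers a ∨ ∃ y ∈ Subgroup.zpowers a, x = b * y
  orderOf_a : orderOf a = 2 * n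
  sq_b : b ^ 2 = a ^ n
  conj_a : b * a * b⁻¹ = a⁻¹
  b_notMem : b ∉ Subgroup.zpowers a
  eq_one : ∀ x ∈ Q, x ∈ Subgroup.zpowers c → x = 1
  exists_mul : ∀ x : X, ∃ q ∈ Q, ∃ y ∈ Subgroup.zpowers c, x = q * y

namespace IsDicyclicFactorization

variable {X : Type*} [Group X] {n : ℕ} {a b c : X} {Q : Subgroup X}

theorem zpowers_a_le (h : IsDicyclicFactorization n a b c Q) : Subgroup.zpowers a ≤ Q :=
  Subgroup.zpowers_le.2 h.a_mem

theorem zpowers_comm {x y : X} (hx : x ∈ Subgroup.zpowers a) (hy : y ∈ Subgroup.zpowers a) :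
    x * y = y * x := by
  obtain ⟨i, rfl⟩ := Subgroup.mem_zpowers_iff.1 hx
  obtain ⟨j, rfl⟩ := Subgroup.mem_zpowers_iff.1 hy
  exact (Commute.zpow_zpow_self a i j).eq

theorem conj_b (h : IsDicyclicFactorization n a b c Q) {y : X} (hy : y ∈ Subgroup.zpowers a) :
    b * y * b⁻¹ = y⁻¹ := by
  obtain ⟨i, rfl⟩ := Subgroup.mem_zpowers_iff.1 hy
  rw [← conj_zpow, h.conj_a, inv_zpow]

theorem conj_of_notMem (h : IsDicyclicFactorization n a b c Q) {x y : X} (hx : x ∈ Q)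
    (hxa : x ∉ Subgroup.zpowers a) (hy : y ∈ Subgroup.zpowers a) : x * y * x⁻¹ = y⁻¹ := by
  obtain hx' | ⟨w, hw, rfl⟩ := h.mem_or x hx
  · exact absurd hx' hxa
  · calc b * w * y * (b * w)⁻¹ = b * (w * y * w⁻¹) * b⁻¹ := by group
      _ = b * y * b⁻¹ := by rw [zpowers_comm hw hy]; group
      _ = y⁻¹ := h.conj_b hy

theorem conj_mem (h : IsDicyclicFactorization n a b c Q) {x y : X} (hx : x ∈ Q)
    (hy : y ∈ Subgroup.zpowers a) : x * y * x⁻¹ ∈ Subgroup.zpowers a := by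
  by_cases hxa : x ∈ Subgroup.zpowers a
  · exact Subgroup.mul_mem _ (Subgroup.mul_mem _ hxa hy) (Subgroup.inv_mem _ hxa)
  · rw [h.conj_of_notMem hx hxa hy]
    exact Subgroup.inv_mem _ hy

theorem sq_of_notMem (h : IsDicyclicFactorization n a b c Q) {x : X} (hx : x ∈ Q)
    (hxa : x ∉ Subgroup.zpowers a) : x ^ 2 = a ^ n := by
  obtain hx' | ⟨w, hw, rfl⟩ := h.mem_or x hx
  · exact absurd hx' hxa
  · have := h.conj_b hw
    calc (b * w) ^ 2 = (b * w * b⁻¹) * b ^ 2 * w := by rw [pow_two, pow_two]; group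
      _ = w⁻¹ * a ^ n * w := by rw [this, h.sq_b]
      _ = a ^ n := by
        rw [mul_assoc, zpowers_comm (Subgroup.npow_mem_zpowers a n) hw]; group

theorem sq_mem (h : IsDicyclicFactorization n a b c Q) {x : X} (hx : x ∈ Q) :
    x ^ 2 ∈ Subgroup.zpowers a := by
  by_cases hxa : x ∈ Subgroup.zpowers a
  · exact Subgroup.pow_mem _ hxa 2
  · rw [h.sq_of_notMem hx hxa]
    exact Subgroup.npow_mem_zpowers a n

theorem involution_mem (_h : IsDicyclicFactorization n a b c Q) : a ^ n ∈ Subgroup.zpowers a :=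
  Subgroup.npow_mem_zpowers a n

theorem involution_sq (h : IsDicyclicFactorization n a b c Q) : (a ^ n) ^ 2 = 1 := by
  rw [← pow_mul, mul_comm, ← h.orderOf_a, pow_orderOf_eq_one]

theorem involution_ne_one (h : IsDicyclicFactorization n a b c Q) : a ^ n ≠ 1 := by
  have := h.pos
  exact pow_ne_one_of_lt_orderOf this.ne' (by rw [h.orderOf_a]; omega)

theorem eq_one_or_eq_involution (h : IsDicyclicFactorization n a b c Q) {x : X} (hx : x ∈ Q)
    (hx2 : x ^ 2 = 1) : x = 1 ∨ x = a ^ n := by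
  by_cases hxa : x ∈ Subgroup.zpowers a
  · obtain ⟨i, rfl⟩ := Subgroup.mem_zpowers_iff.1 hxa
    have h1 : a ^ (i * 2) = 1 := by rw [zpow_mul]; exact_mod_cast hx2
    rw [← orderOf_dvd_iff_zpow_eq_one, h.orderOf_a] at h1
    push_cast at h1
    obtain ⟨j, hj⟩ : (n : ℤ) ∣ i := by
      rw [mul_comm] at h1
      exact Int.dvd_of_mul_dvd_mul_right (by norm_num) h1
    have hz := h.involution_sq
    have e : a ^ i = (a ^ n) ^ j := by rw [hj, zpow_mul, zpow_natCast]
    rw [e]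
    obtain ⟨k, rfl | rfl⟩ := Int.even_or_odd' j
    · left
      rw [zpow_mul]
      have : (a ^ n) ^ (2 : ℤ) = 1 := by exact_mod_cast hz
      rw [this, one_zpow]
    · right
      rw [zpow_add, zpow_mul]
      have : (a ^ n) ^ (2 : ℤ) = 1 := by exact_mod_cast hz
      rw [this, one_zpow, one_mul, zpow_one]
  · exact absurd ((h.sq_of_notMem hx hxa).symm.trans hx2) h.involution_ne_one

theorem involution_comm (h : IsDicyclicFactorization n a b c Q) {x : X} (hx : x ∈ Q) :
    x * a ^ n * x⁻¹ = a ^ n := by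
  have h2 : (x * a ^ n * x⁻¹) ^ 2 = 1 := by
    rw [conj_pow, h.involution_sq]; group
  obtain h1 | h1 := h.eq_one_or_eq_involution
    (h.zpowers_a_le (h.conj_mem hx h.involution_mem)) h2
  · exact absurd (conj_eq_one_iff.1 h1) h.involution_ne_one
  · exact h1

/-- Elements of odd exponent modulo `⟨a⟩` lie in `⟨a⟩`. -/
theorem mem_zpowers_of_odd_pow_mem (h : IsDicyclicFactorization n a b c Q) {x : X} (hx : x ∈ Q)
    {k : ℕ} (hk : Odd k) (hxk : x ^ k ∈ Subgroup.zpowers a) : x ∈ Subgroup.zpowers a := by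
  obtain ⟨m, rfl⟩ := hk
  rw [pow_succ, pow_mul] at hxk
  exact (Subgroup.mul_mem_cancel_left _ (Subgroup.pow_mem _ (h.sq_mem hx) m)).1 hxk

theorem eq_one_of_forall_conj_mem (h : IsDicyclicFactorization n a b c Q)
    (hA : ∀ x : X, (∀ g : X, g * x * g⁻¹ ∈ Subgroup.zpowers a) → x = 1) {x : X}
    (hx : ∀ g : X, g * x * g⁻¹ ∈ Q) : x = 1 := by
  have key : ∀ y : X, (∀ g : X, g * y * g⁻¹ ∈ Q) → y ^ 2 = 1 := fun y hy =>
    hA _ fun g => by rw [← conj_pow]; exact h.sq_mem (hy g)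
  refine hA x fun g => ?_
  have h2 : (g * x * g⁻¹) ^ 2 = 1 := by rw [conj_pow, key x hx]; group
  obtain h1 | h1 := h.eq_one_or_eq_involution (hx g) h2
  · rw [h1]; exact Subgroup.one_mem _
  · rw [h1]; exact h.involution_mem

theorem eq_one_of_conj_mem (h : IsDicyclicFactorization n a b c Q) {y g : X}
    (hy : y ∈ Subgroup.zpowers c) (hg : g * y * g⁻¹ ∈ Q) : y = 1 := by
  obtain ⟨q, hq, w, hw, rfl⟩ := h.exists_mul g
  have e : q⁻¹ * (q * w * y * (q * w)⁻¹) * q = y := by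
    calc _ = w * y * w⁻¹ := by group
      _ = y := by rw [zpowers_comm hw hy]; group
  refine h.eq_one y ?_ hy
  rw [← e]
  exact Q.mul_mem (Q.mul_mem (Q.inv_mem hq) hg) hq

theorem card_eq [Finite X] (h : IsDicyclicFactorization n a b c Q) :
    Nat.card X = Nat.card Q * Nat.card (Subgroup.zpowers c) := by
  rw [← Nat.card_prod]
  refine (Nat.card_congr (Equiv.ofBijective
    (fun z : Q × Subgroup.zpowers c => (z.1 : X) * z.2) ⟨?_, ?_⟩)).symm
  · rintro ⟨⟨u, hu⟩, ⟨v, hv⟩⟩ ⟨⟨u', hu'⟩, ⟨v', hv'⟩⟩ huv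
    have huv : u * v = u' * v' := huv
    have e : u'⁻¹ * u = v' * v⁻¹ := by
      rw [inv_mul_eq_iff_eq_mul, ← mul_assoc, ← huv]; group
    have e1 := h.eq_one (u'⁻¹ * u) (Q.mul_mem (Q.inv_mem hu') hu)
      (e ▸ Subgroup.mul_mem _ hv' (Subgroup.inv_mem _ hv))
    rw [e1] at e
    simp only [Prod.mk.injEq, Subtype.mk.injEq]
    exact ⟨(inv_mul_eq_one.1 e1).symm, (mul_inv_eq_one.1 e.symm).symm⟩
  · intro x
    obtain ⟨q, hq, y, hy, rfl⟩ := h.exists_mul x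
    exact ⟨(⟨q, hq⟩, ⟨y, hy⟩), rfl⟩

theorem exists_normal_isPGroup [Finite X] (h : IsDicyclicFactorization n a b c Q) :
    ∃ p : ℕ, p.Prime ∧ ∃ P : Subgroup X, P.Normal ∧ IsPGroup p P ∧ P ≠ ⊥ := by
  have hX := h.card_eq
  have hQ1 : 1 < Nat.card Q := by
    refine (Subgroup.one_lt_card_iff_ne_bot Q).2 fun hb => h.involution_ne_one ?_
    simpa [hb] using h.zpowers_a_le h.involution_mem
  rcases lt_or_ge (Nat.card (Subgroup.zpowers c)) (Nat.card Q) with hlt | hge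
  · refine exists_normal_isPGroup_of_forall_inf_conj_ne_bot (Subgroup.zpowers a)
      (fun x hx y hy => zpowers_comm hx hy) fun g => ?_
    have : ∃ y ∈ Q, g⁻¹ * y * g ∈ Q ∧ y ≠ 1 := by
      by_contra! hcon
      have := (Q.card_mul_self_le_of_inf_conj_eq_bot g hcon).1
      rw [hX] at this
      exact absurd (Nat.le_of_mul_le_mul_left this (by omega)) (by omega)
    obtain ⟨y, hy, hyg, hy1⟩ := this
    have e : (g⁻¹ * y * g) ^ 2 = g⁻¹ * y ^ 2 * g := by
      have := conj_pow (a := g⁻¹) (b := y) (i := 2)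
      rwa [inv_inv] at this
    by_cases hy2 : y ^ 2 = 1
    · refine ⟨y, ?_, ?_, hy1⟩
      · obtain h1 | h1 := h.eq_one_or_eq_involution hy hy2
        · exact absurd h1 hy1
        · rw [h1]; exact h.involution_mem
      · obtain h1 | h1 := h.eq_one_or_eq_involution hyg (by rw [e, hy2]; group)
        · rw [h1]; exact Subgroup.one_mem _
        · rw [h1]; exact h.involution_mem
    · exact ⟨y ^ 2, h.sq_mem hy, e ▸ h.sq_mem hyg, hy2⟩
  · refine exists_normal_isPGroup_of_forall_inf_conj_ne_bot (Subgroup.zpowers c)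
      (fun x hx y hy => zpowers_comm hx hy) fun g => ?_
    by_contra! hcon
    by_cases hg : g ∈ Subgroup.zpowers c
    · have : Subgroup.zpowers c = ⊥ := (Subgroup.eq_bot_iff_forall _).2 fun y hy =>
        hcon y hy (Subgroup.mul_mem _ (Subgroup.mul_mem _ (Subgroup.inv_mem _ hg) hy) hg)
      rw [this, Subgroup.card_bot] at hge
      omega
    · have := ((Subgroup.zpowers c).card_mul_self_le_of_inf_conj_eq_bot g hcon).2 hg
      rw [hX] at this
      exact absurd (Nat.mul_le_mul_right (Nat.card (Subgroup.zpowers c)) hge) (by omega)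

end IsDicyclicFactorization

/-- A finite group with a nontrivial normal `p`-subgroup has a nontrivial normal subgroup of
exponent `p` that is centralized by every normal `p`-subgroup. -/
theorem exists_normal_pow_eq_one_of_isPGroup {G : Type*} [Group G] [Finite G] {p : ℕ}
    (hp : p.Prime) {P₀ : Subgroup G} (hn : P₀.Normal) (hP₀ : IsPGroup p P₀) (hb : P₀ ≠ ⊥) :
    ∃ E : Subgroup G, E.Normal ∧ E ≠ ⊥ ∧ (∀ x ∈ E, x ^ p = 1) ∧
      ∀ N : Subgroup G, N.Normal → IsPGroup p N → ∀ x ∈ E, ∀ y ∈ N, x * y = y * x := by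
  have := Fact.mk hp
  obtain ⟨P, ⟨hPn, hP⟩, hmax⟩ := (Set.toFinite
    {P : Subgroup G | P.Normal ∧ IsPGroup p P}).exists_maximal ⟨P₀, hn, hP₀⟩
  have hle : ∀ N : Subgroup G, N.Normal → IsPGroup p N → N ≤ P := fun N hN hNp =>
    (le_sup_right : N ≤ P ⊔ N).trans
      (hmax ⟨inferInstance, hP.to_sup_of_normal_left hNp⟩ le_sup_left)
  have hnt : Nontrivial P := by
    rw [Subgroup.nontrivial_iff_ne_bot]
    rintro rfl
    exact hb (le_bot_iff.1 (hle P₀ hn hP₀))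
  refine ⟨{ carrier := {x | x ∈ P ∧ x ^ p = 1 ∧ ∀ y ∈ P, Commute x y}
            one_mem' := ⟨P.one_mem, one_pow p, fun y _ => Commute.one_left y⟩
            mul_mem' := ?_
            inv_mem' := ?_ }, ⟨?_⟩, ?_, ?_, ?_⟩
  · rintro x y ⟨hx, hxp, hxc⟩ ⟨hy, hyp, hyc⟩
    refine ⟨P.mul_mem hx hy, ?_, fun z hz => (hxc z hz).mul_left (hyc z hz)⟩
    rw [(hxc y hy).mul_pow, hxp, hyp, one_mul]
  · rintro x ⟨hx, hxp, hxc⟩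
    exact ⟨P.inv_mem hx, by rw [inv_pow, hxp, inv_one], fun z hz => (hxc z hz).inv_left⟩
  · rintro x ⟨hx, hxp, hxc⟩ g
    refine ⟨hPn.conj_mem x hx g, by rw [conj_pow, hxp]; group, fun y hy => ?_⟩
    have := hxc (g⁻¹ * y * g) (by simpa using hPn.conj_mem y hy g⁻¹)
    have := this.map (MulAut.conj g)
    simpa [mul_assoc] using this
  · have hcn := hP.center_nontrivial
    obtain ⟨⟨z, hzc⟩, hz1⟩ := exists_ne (1 : Subgroup.center P)
    have hz1' : (z : G) ≠ 1 := fun hz => hz1 (Subtype.ext (Subtype.ext hz))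
    obtain ⟨k, hk⟩ := (IsPGroup.iff_orderOf.1 hP) z
    have hd : p ∣ orderOf (z : G) := by
      rw [Subgroup.orderOf_coe, hk]
      refine dvd_pow_self p ?_
      rintro rfl
      rw [pow_zero, orderOf_eq_one_iff] at hk
      exact hz1' (by rw [hk]; rfl)
    have ho : orderOf ((z : G) ^ (orderOf (z : G) / p)) = p :=
      orderOf_pow_orderOf_div (orderOf_pos _).ne' hd
    intro hbot
    have hmem : (z : G) ^ (orderOf (z : G) / p) ∈ (⊥ : Subgroup G) := by
      rw [← hbot]
      refine ⟨P.pow_mem z.2 _, ?_, fun y hy => Commute.pow_left ?_ _⟩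
      · nth_rewrite 2 [← ho]
        exact pow_orderOf_eq_one _
      · have := Subgroup.mem_center_iff.1 hzc ⟨y, hy⟩
        exact (congrArg Subtype.val this).symm
    rw [Subgroup.mem_bot] at hmem
    rw [hmem, orderOf_one] at ho
    exact hp.one_lt.ne ho
  · exact fun x hx => hx.2.1
  · exact fun N hN hNp x hx y hy => hx.2.2 y (hle N hN hNp hy)

namespace IsDicyclicFactorization

variable {X : Type*} [Group X] {n : ℕ} {a b c : X} {Q : Subgroup X}

/-- A nontrivial elementary abelian normal `p`-subgroup `T` with `T ∩ Q ≤ ⟨a⟩` that contains every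
normal `p`-subgroup inside `T ⊔ Q` and its own centralizer in the core of `T ⊔ Q`. -/
structure IsLocalSocle (p : ℕ) (a : X) (Q T : Subgroup X) : Prop where
  normal : T.Normal
  ne_bot : T ≠ ⊥
  pow_eq_one : ∀ x ∈ T, x ^ p = 1
  comm : ∀ x ∈ T, ∀ y ∈ T, x * y = y * x
  mem_zpowers : ∀ x ∈ T, x ∈ Q → x ∈ Subgroup.zpowers a
  le_of_isPGroup : ∀ N : Subgroup X, N.Normal → IsPGroup p N → N ≤ T ⊔ Q → N ≤ T
  mem_of_comm : ∀ x ∈ (T ⊔ Q).normalCore, (∀ t ∈ T, x * t = t * x) → x ∈ T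

theorem exists_isLocalSocle [Finite X] (h : IsDicyclicFactorization n a b c Q)
    (hA : ∀ x : X, (∀ g : X, g * x * g⁻¹ ∈ Subgroup.zpowers a) → x = 1) {p : ℕ} (hp : p.Prime)
    {E : Subgroup X} (hEn : E.Normal) (hE : E ≠ ⊥) (hEp : ∀ x ∈ E, x ^ p = 1)
    (hEc : ∀ N : Subgroup X, N.Normal → IsPGroup p N → ∀ x ∈ E, ∀ y ∈ N, x * y = y * x) :
    ∃ T : Subgroup X, IsLocalSocle p a Q T := by
  have hEP : IsPGroup p E := fun x => ⟨1, Subtype.ext (by simpa using hEp x x.2)⟩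
  set T : Subgroup X := (E ⊔ Q).normalCore ⊓ Subgroup.centralizer E with hT
  have hTn : T.Normal := inferInstance
  have hTE : ∀ t ∈ T, ∀ e ∈ E, e * t = t * e := fun t ht e he =>
    Subgroup.mem_centralizer_iff.1 ht.2 e he
  have hET : E ≤ T := le_inf (Subgroup.normal_le_normalCore.2 le_sup_left) fun x hx =>
    Subgroup.mem_centralizer_iff.2 fun y hy => hEc E hEn hEP y hy x hx
  have hsup : T ⊔ Q = E ⊔ Q := le_antisymm
    (sup_le (inf_le_left.trans (Subgroup.normalCore_le _)) le_sup_right)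
    (sup_le_sup_right hET Q)
  have hdec : ∀ t ∈ T, ∃ e ∈ E, ∃ u ∈ T, u ∈ Q ∧ t = e * u := by
    intro t ht
    obtain ⟨e, he, u, hu, rfl⟩ := Subgroup.mem_sup_of_normal_left.1 (Subgroup.normalCore_le _ ht.1)
    exact ⟨e, he, u, (Subgroup.mul_mem_cancel_left _ (hET he)).1 ht, hu, rfl⟩
  have hpow : ∀ x ∈ T, x ∈ Q → x ^ p = 1 := by
    intro x hx _
    refine h.eq_one_of_forall_conj_mem hA fun g => ?_
    obtain ⟨e, he, u, hu, huQ, heu⟩ := hdec _ (hTn.conj_mem x hx g)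
    rw [← conj_pow, heu, (show Commute e u from hTE u hu e he).mul_pow, hEp e he, one_mul]
    exact Q.pow_mem huQ p
  have hcomm : ∀ x ∈ T, ∀ y ∈ T, x * y = y * x := by
    intro x hx y hy
    rw [← mul_inv_eq_one, mul_inv_rev]
    refine h.eq_one_of_forall_conj_mem hA fun g => ?_
    obtain ⟨e, he, u, hu, huQ, heu⟩ := hdec _ (hTn.conj_mem x hx g)
    obtain ⟨f, hf, v, hv, hvQ, hfv⟩ := hdec _ (hTn.conj_mem y hy g)
    have e1 : g * (x * y * (x⁻¹ * y⁻¹)) * g⁻¹ = (g * x * g⁻¹) * (g * y * g⁻¹) * (g * x * g⁻¹)⁻¹ *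
      (g * y * g⁻¹)⁻¹ := by group
    have e2 : e * u * (f * v) * (e * u)⁻¹ * (f * v)⁻¹ = u * v * u⁻¹ * v⁻¹ := by
      have c1 := hTE u hu e he
      have c2 := hTE v hv e he
      have c3 := hTE u hu f hf
      have c4 := hTE v hv f hf
      have c5 := hTE f (hET hf) e he
      calc _ = (e * u) * (f * v) * u⁻¹ * e⁻¹ * v⁻¹ * f⁻¹ := by group
        _ = (u * e) * (f * v) * u⁻¹ * e⁻¹ * v⁻¹ * f⁻¹ := by rw [c1]
        _ = u * (e * f) * v * u⁻¹ * e⁻¹ * v⁻¹ * f⁻¹ := by group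
        _ = u * f * (e * v) * u⁻¹ * e⁻¹ * v⁻¹ * f⁻¹ := by rw [c5]; group
        _ = (u * f) * v * (e * u⁻¹) * e⁻¹ * v⁻¹ * f⁻¹ := by rw [c2]; group
        _ = (f * u) * v * (u⁻¹ * e) * e⁻¹ * v⁻¹ * f⁻¹ := by
          rw [c3, (show Commute e u from c1).inv_right.eq]
        _ = f * (u * v * u⁻¹ * v⁻¹) * f⁻¹ := by group
        _ = _ := by
          have : u * v * u⁻¹ * v⁻¹ ∈ T :=
            T.mul_mem (T.mul_mem (T.mul_mem hu hv) (T.inv_mem hu)) (T.inv_mem hv)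
          rw [hTE _ this f hf]; group
    rw [e1, heu, hfv, e2]
    exact Q.mul_mem (Q.mul_mem (Q.mul_mem huQ hvQ) (Q.inv_mem huQ)) (Q.inv_mem hvQ)
  refine ⟨T, hTn, fun hb => hE (le_bot_iff.1 (hb ▸ hET)), ?_, hcomm, ?_, ?_, ?_⟩
  · intro t ht
    obtain ⟨e, he, u, hu, huQ, rfl⟩ := hdec t ht
    rw [(show Commute e u from hTE u hu e he).mul_pow, hEp e he, one_mul, hpow u hu huQ]
  · intro x hx hxQ
    have hxp := hpow x hx hxQ
    obtain rfl | hodd := hp.eq_two_or_odd'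
    · obtain rfl | rfl := h.eq_one_or_eq_involution hxQ hxp
      · exact Subgroup.one_mem _
      · exact h.involution_mem
    · exact h.mem_zpowers_of_odd_pow_mem hxQ hodd (by rw [hxp]; exact Subgroup.one_mem _)
  · intro N hN hNp hNQ
    rw [hsup] at hNQ
    exact le_inf (Subgroup.normal_le_normalCore.2 hNQ) fun x hx =>
      Subgroup.mem_centralizer_iff.2 fun y hy => hEc N hN hNp y hy x hx
  · intro x hx hxT
    rw [hsup] at hx
    exact ⟨hx, Subgroup.mem_centralizer_iff.2 fun y hy => (hxT y (hET hy)).symm⟩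

theorem card_inf_sup_mul [Finite X] (h : IsDicyclicFactorization n a b c Q) (T : Subgroup X)
    [T.Normal] : Nat.card (Q.subgroupOf T) *
      Nat.card (Subgroup.zpowers c ⊓ (T ⊔ Q) : Subgroup X) = Nat.card T := by
  rw [← Subgroup.card_mul_index (Q.subgroupOf T)]
  congr 1
  have hdec : ∀ y : (Subgroup.zpowers c ⊓ (T ⊔ Q) : Subgroup X), ∃ t : T, ∃ q ∈ Q, y.1 = t * q := by
    rintro ⟨y, hy, hyT⟩
    obtain ⟨t, ht, q, hq, e⟩ := Subgroup.mem_sup_of_normal_left.1 hyT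
    exact ⟨⟨t, ht⟩, q, hq, e.symm⟩
  choose f q hq hf using hdec
  refine Nat.card_congr (Equiv.ofBijective
    (fun y => (QuotientGroup.mk (f y) : T ⧸ Q.subgroupOf T)) ⟨?_, ?_⟩)
  · intro y y' hyy
    have hm : (f y)⁻¹ * f y' ∈ Q.subgroupOf T := QuotientGroup.eq.1 hyy
    replace hm : (f y : X)⁻¹ * f y' ∈ Q := hm
    have e : (y : X)⁻¹ * y' = (q y)⁻¹ * ((f y : X)⁻¹ * f y') * q y' := by
      rw [hf y, hf y']; group
    have := h.eq_one ((y : X)⁻¹ * y')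
      (e ▸ Q.mul_mem (Q.mul_mem (Q.inv_mem (hq y)) hm) (hq y'))
      (Subgroup.mul_mem _ (Subgroup.inv_mem _ y.2.1) y'.2.1)
    exact Subtype.ext (inv_mul_eq_one.1 this)
  · intro w
    obtain ⟨t, rfl⟩ := QuotientGroup.mk_surjective w
    obtain ⟨r, hr, y, hy, e⟩ := h.exists_mul (t : X)⁻¹
    have e' : y⁻¹ = t * r := by rw [← inv_inv (t : X), e]; group
    refine ⟨⟨y⁻¹, Subgroup.inv_mem _ hy, ?_⟩, QuotientGroup.eq.2 ?_⟩
    · rw [e']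
      exact Subgroup.mul_mem_sup t.2 hr
    · set y' : (Subgroup.zpowers c ⊓ (T ⊔ Q) : Subgroup X) := ⟨y⁻¹, _⟩
      have : (f y' : X)⁻¹ * t = q y' * r⁻¹ := by
        rw [inv_mul_eq_iff_eq_mul, ← mul_assoc, ← hf y', eq_mul_inv_iff_mul_eq, ← e']
      exact (this ▸ Q.mul_mem (hq y') (Q.inv_mem hr) : (f y' : X)⁻¹ * t ∈ Q)

end IsDicyclicFactorization

theorem Subgroup.mem_of_pow_mem_of_odd {G : Type*} [Group G] {H : Subgroup G} {x : G} {m : ℕ}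
    (hm : Odd m) (h2 : x ^ 2 ∈ H) (hxm : x ^ m ∈ H) : x ∈ H := by
  obtain ⟨k, rfl⟩ := hm
  rw [pow_succ, pow_mul] at hxm
  exact (H.mul_mem_cancel_left (H.pow_mem h2 k)).1 hxm

namespace IsDicyclicFactorization

variable {X : Type*} [Group X] {n p : ℕ} {a b c : X} {Q T : Subgroup X}

theorem IsLocalSocle.mem_of_pow_eq_one (hT : IsLocalSocle p a Q T) (haQ : Subgroup.zpowers a ≤ Q)
    {w : X} (hw : w ∈ (T ⊔ Subgroup.zpowers a).normalCore) {k : ℕ} (hk : w ^ p ^ k = 1) :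
    w ∈ T := by
  have hn := hT.normal
  have hcomm : ∀ x ∈ (T ⊔ Subgroup.zpowers a).normalCore,
      ∀ y ∈ (T ⊔ Subgroup.zpowers a).normalCore,
      Commute (QuotientGroup.mk' T x) (QuotientGroup.mk' T y) := by
    intro x hx y hy
    obtain ⟨t, ht, u, hu, rfl⟩ := Subgroup.mem_sup_of_normal_left.1 (Subgroup.normalCore_le _ hx)
    obtain ⟨s, hs, v, hv, rfl⟩ := Subgroup.mem_sup_of_normal_left.1 (Subgroup.normalCore_le _ hy)
    have e : ∀ t ∈ T, QuotientGroup.mk' T t = 1 := fun t ht =>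
      (QuotientGroup.eq_one_iff t).2 ht
    rw [map_mul, map_mul, e t ht, e s hs, one_mul, one_mul]
    exact (show Commute u v from zpowers_comm hu hv).map _
  let V : Subgroup X :=
    { carrier := {x | x ∈ (T ⊔ Subgroup.zpowers a).normalCore ∧ ∃ k, x ^ p ^ k = 1}
      one_mem' := ⟨Subgroup.one_mem _, 0, one_pow _⟩
      inv_mem' := fun {x} ⟨hx, k, hk⟩ => ⟨Subgroup.inv_mem _ hx, k, by rw [inv_pow, hk, inv_one]⟩
      mul_mem' := by
        rintro x y ⟨hx, i, hi⟩ ⟨hy, j, hj⟩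
        refine ⟨Subgroup.mul_mem _ hx hy, i + j + 1, ?_⟩
        have hm : (x * y) ^ p ^ (i + j) ∈ T := by
          rw [← QuotientGroup.eq_one_iff]
          change QuotientGroup.mk' T _ = 1
          rw [map_pow, map_mul, (hcomm x hx y hy).mul_pow, ← map_pow, ← map_pow, pow_add, pow_mul,
            hi, mul_comm, pow_mul, hj, one_pow, one_pow, map_one, one_mul]
        rw [pow_succ, pow_mul]
        exact hT.pow_eq_one _ hm }
  have hVn : V.Normal := ⟨by
    rintro x ⟨hx, k, hk⟩ g
    exact ⟨(Subgroup.normalCore_normal _).conj_mem x hx g, k, by rw [conj_pow, hk]; group⟩⟩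
  refine hT.le_of_isPGroup V hVn ?_ ?_ ⟨hw, k, hk⟩
  · rintro ⟨x, hx, k, hk⟩
    exact ⟨k, Subtype.ext hk⟩
  · rintro x ⟨hx, -⟩
    exact sup_le_sup_left haQ T (Subgroup.normalCore_le _ hx)

theorem IsLocalSocle.sq_mem (hT : IsLocalSocle p a Q T) (h : IsDicyclicFactorization n a b c Q)
    {x : X} (hx : x ∈ (T ⊔ Q).normalCore) : x ^ 2 ∈ (T ⊔ Subgroup.zpowers a).normalCore := by
  have hn := hT.normal
  intro g
  rw [← conj_pow]
  obtain ⟨t, ht, q, hq, e⟩ := Subgroup.mem_sup_of_normal_left.1 (hx g)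
  have e2 : (t * q) ^ 2 = t * (q * t * q⁻¹) * q ^ 2 := by rw [pow_two, pow_two]; group
  rw [← e, e2]
  exact Subgroup.mul_mem_sup (T.mul_mem ht (hn.conj_mem t ht q)) (h.sq_mem hq)

theorem mem_normalCore_of_mem_sup (h : IsDicyclicFactorization n a b c Q) {T : Subgroup X}
    [T.Normal] {y : X} (hy : y ∈ Subgroup.zpowers c) (hyT : y ∈ T ⊔ Q) :
    y ∈ (T ⊔ Q).normalCore := by
  intro g
  obtain ⟨q, hq, w, hw, rfl⟩ := h.exists_mul g
  have e : q * w * y * (q * w)⁻¹ = q * y * q⁻¹ := by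
    calc _ = q * (w * y) * w⁻¹ * q⁻¹ := by group
      _ = q * y * q⁻¹ := by rw [zpowers_comm hw hy]; group
  have hq' : q ∈ T ⊔ Q := le_sup_right (a := T) hq
  rw [e]
  exact Subgroup.mul_mem _ (Subgroup.mul_mem _ hq' hyT) (Subgroup.inv_mem _ hq')

theorem IsLocalSocle.normalCore_sup_le [Finite X] (hT : IsLocalSocle 2 a Q T)
    (h : IsDicyclicFactorization n a b c Q)
    (hA : ∀ x : X, (∀ g : X, g * x * g⁻¹ ∈ Subgroup.zpowers a) → x = 1)
    (hcard : Nat.card T ≤ 8) (hz : a ^ n ∈ T) : (T ⊔ Subgroup.zpowers a).normalCore ≤ T := by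
  have hn := hT.normal
  have hTsq : ∀ x ∈ T, x * x = 1 := fun x hx => by rw [← pow_two, hT.pow_eq_one x hx]
  intro w hw
  by_contra hwT
  obtain ⟨k, m, hm, hkm⟩ := Nat.exists_eq_two_pow_mul_odd (orderOf_pos w).ne'
  obtain ⟨x, hx, hxT, hxm⟩ : ∃ x ∈ (T ⊔ Subgroup.zpowers a).normalCore, x ∉ T ∧ x ^ m = 1 := by
    refine ⟨w ^ 2 ^ k, Subgroup.pow_mem _ hw _, fun hmem => hwT ?_, ?_⟩
    · exact hT.mem_of_pow_eq_one h.zpowers_a_le hw (k := k + 1)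
        (by rw [pow_succ, pow_mul, hT.pow_eq_one _ hmem])
    · rw [← pow_mul, ← hkm, pow_orderOf_eq_one]
  have hzW : ∀ w ∈ T ⊔ Subgroup.zpowers a, a ^ n * w = w * a ^ n := by
    intro w hw
    obtain ⟨t, ht, y, hy, rfl⟩ := Subgroup.mem_sup_of_normal_left.1 hw
    exact (show Commute (a ^ n) t from hT.comm _ hz t ht).mul_right
      (show Commute (a ^ n) y from zpowers_comm h.involution_mem hy)
  obtain ⟨g, hg⟩ : ∃ g : X, g * a ^ n * g⁻¹ ∉ Subgroup.zpowers a := by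
    by_contra! hcon
    exact h.involution_ne_one (hA _ hcon)
  set u := g * a ^ n * g⁻¹ with hu
  have huT : u ∈ T := hn.conj_mem _ hz g
  have hux : u * x = x * u := by
    have hx' := hzW _ (Subgroup.normalCore_le _
      ((Subgroup.normalCore_normal _).conj_mem x hx g⁻¹))
    have := (show Commute _ _ from hx').map (MulAut.conj g)
    simpa [hu, mul_assoc] using this.eq
  have hzx : a ^ n * x = x * a ^ n := hzW x (Subgroup.normalCore_le _ hx)
  set Z : Subgroup T := (Subgroup.centralizer {x}).subgroupOf T with hZ
  have hZmem : ∀ t : T, t ∈ Z ↔ (t : X) * x = x * t := fun t => by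
    rw [hZ, Subgroup.mem_subgroupOf, Subgroup.mem_centralizer_singleton_iff]
  have hZ4 : 4 ≤ Nat.card Z := by
    classical
    have := Fintype.ofFinite Z
    let z' : Z := ⟨⟨a ^ n, hz⟩, (hZmem _).2 hzx⟩
    let u' : Z := ⟨⟨u, huT⟩, (hZmem _).2 hux⟩
    have hz1 : z' ≠ 1 := fun e =>
      h.involution_ne_one (congrArg (fun t : Z => ((t : T) : X)) e)
    have hu1 : u' ≠ 1 := fun e => by
      have e' : u = 1 := congrArg (fun t : Z => ((t : T) : X)) e
      exact hg (e' ▸ Subgroup.one_mem _)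
    have hzz : z' * z' = 1 := Subtype.ext (Subtype.ext (hTsq _ hz))
    have huz : z' ≠ u' := fun e => by
      have e' : a ^ n = u := congrArg (fun t : Z => ((t : T) : X)) e
      exact hg (e' ▸ h.involution_mem)
    have hzu : z' * u' ≠ 1 := fun e => huz (mul_left_cancel (hzz.trans e.symm))
    have h4 : ({1, z', u', z' * u'} : Finset Z).card = 4 := by
      rw [Finset.card_insert_of_notMem, Finset.card_insert_of_notMem,
        Finset.card_insert_of_notMem, Finset.card_singleton]
      · simpa using hz1
      · simpa using ⟨huz, hu1⟩
      · simpa using ⟨hz1.symm, hu1.symm, hzu.symm⟩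
    rw [Nat.card_eq_fintype_card, ← h4]
    exact Finset.card_le_univ _
  have hind : Z.index = 1 ∨ Z.index = 2 := by
    have e := Z.card_mul_index
    have : Z.index ≠ 0 := Subgroup.index_ne_zero_of_finite
    have : Z.index ≤ 2 := by nlinarith
    omega
  have hconj : ∀ t : T, x * (t : X) * x⁻¹ ∈ T := fun t => hn.conj_mem _ t.2 x
  have hv : ∀ t : T, t⁻¹ * ⟨x * (t : X) * x⁻¹, hconj t⟩ ∈ Z := by
    intro t
    obtain h1 | h2 := hind
    · rw [Subgroup.index_eq_one.1 h1]; trivial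
    · rw [Subgroup.mul_mem_iff_of_index_two h2, inv_mem_iff, hZmem, hZmem]
      constructor
      · intro ht
        simp [← ht]
      · intro ht
        have := congrArg (fun y => x⁻¹ * y * x) ht
        simpa [mul_assoc] using this
  refine hxT (hT.mem_of_comm x ?_ fun t ht => ?_)
  · exact Subgroup.normalCore_mono (sup_le_sup_left h.zpowers_a_le T) hx
  · have hv' := hv ⟨t, ht⟩
    set v : X := t⁻¹ * (x * t * x⁻¹) with hvdef
    have hvx : v * x = x * v := (hZmem _).1 hv'
    have hvT : v ∈ T := T.mul_mem (T.inv_mem ht) (hn.conj_mem t ht x)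
    have e1 : x * t * x⁻¹ = t * v := by rw [hvdef]; group
    have e2 : x ^ 2 * t = t * x ^ 2 := by
      calc x ^ 2 * t = x * (x * t * x⁻¹) * x := by rw [pow_two]; group
        _ = x * (t * v) * x := by rw [e1]
        _ = (x * t * x⁻¹) * (x * v) * x := by group
        _ = t * (v * v) * x * x := by rw [← hvx, e1]; group
        _ = _ := by rw [hTsq v hvT, mul_one, pow_two, mul_assoc]
    have := Subgroup.mem_of_pow_mem_of_odd (H := Subgroup.centralizer {t}) (x := x) hm
      (Subgroup.mem_centralizer_singleton_iff.2 e2) (by rw [hxm]; exact Subgroup.one_mem _)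
    exact Subgroup.mem_centralizer_singleton_iff.1 this

theorem IsLocalSocle.isPGroup (hT : IsLocalSocle p a Q T) : IsPGroup p T :=
  fun x => ⟨1, Subtype.ext (by simpa using hT.pow_eq_one x x.2)⟩

theorem IsLocalSocle.exists_pow_eq_one [Finite X] (hT : IsLocalSocle p a Q T) (hp : p.Prime)
    (h : IsDicyclicFactorization n a b c Q) {y : X} (hy : y ∈ Subgroup.zpowers c)
    (hyT : y ∈ T ⊔ Q) : ∃ k, y ^ p ^ k = 1 := by
  have := hT.normal
  have := Fact.mk hp
  obtain ⟨k, hk⟩ := IsPGroup.iff_card.1 hT.isPGroup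
  have hcard := h.card_inf_sup_mul T
  rw [hk] at hcard
  have hd : orderOf y ∣ p ^ k := by
    refine dvd_trans ?_ (Dvd.intro_left _ hcard)
    exact Subgroup.orderOf_dvd_natCard _ ⟨hy, hyT⟩
  exact ⟨k, orderOf_dvd_iff_pow_eq_one.1 hd⟩

theorem IsLocalSocle.mem_of_mem_sup [Finite X] (hT : IsLocalSocle p a Q T) (hp : p.Prime)
    (h : IsDicyclicFactorization n a b c Q)
    (hA : ∀ x : X, (∀ g : X, g * x * g⁻¹ ∈ Subgroup.zpowers a) → x = 1) {y : X}
    (hy : y ∈ Subgroup.zpowers c) (hyT : y ∈ T ⊔ Q) : y ∈ T := by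
  have hn := hT.normal
  have hsq : ∀ y ∈ Subgroup.zpowers c, y ∈ T ⊔ Q → y ^ 2 ∈ T := by
    intro y hy hyT
    obtain ⟨k, hk⟩ := hT.exists_pow_eq_one hp h hy hyT
    exact hT.mem_of_pow_eq_one h.zpowers_a_le (hT.sq_mem h (h.mem_normalCore_of_mem_sup hy hyT))
      (k := k) (by rw [← pow_mul, mul_comm, pow_mul, hk, one_pow])
  obtain rfl | hodd := hp.eq_two_or_odd'
  swap
  · obtain ⟨k, hk⟩ := hT.exists_pow_eq_one hp h hy hyT
    exact Subgroup.mem_of_pow_mem_of_odd (hodd.pow (n := k)) (hsq y hy hyT)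
      (by rw [hk]; exact T.one_mem)
  have hyM := h.mem_normalCore_of_mem_sup hy hyT
  have hTQ : ∀ x ∈ T, x ∈ Q → x = 1 ∨ x = a ^ n := fun x hx hxQ =>
    h.eq_one_or_eq_involution hxQ (hT.pow_eq_one x hx)
  by_cases hz : a ^ n ∈ T
  · have hcard : Nat.card T ≤ 8 := by
      rw [← h.card_inf_sup_mul T]
      have h1 : Nat.card (Q.subgroupOf T) ≤ 2 := by
        have hle : Nat.card (Q.subgroupOf T) ≤ ({1, a ^ n} : Set X).ncard := by
          rw [← Nat.card_coe_set_eq]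
          refine Nat.card_le_card_of_injective
            (fun x => ⟨((x : T) : X), hTQ _ x.1.2 x.2⟩) fun x y hxy => ?_
          exact Subtype.ext (Subtype.ext (Subtype.mk.inj hxy))
        exact hle.trans ((Set.ncard_insert_le _ _).trans (by rw [Set.ncard_singleton]))
      have h2 : Nat.card (Subgroup.zpowers c ⊓ (T ⊔ Q) : Subgroup X) ≤ 4 := by
        refine le_trans ?_ (Subgroup.ncard_pow_eq_one_le (m := 4) (by norm_num) c)
        rw [← SetLike.coe_sort_coe, Nat.card_coe_set_eq]
        refine Set.ncard_le_ncard fun x hx => ⟨hx.1, ?_⟩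
        rw [show 4 = 2 * 2 from rfl, pow_mul, hT.pow_eq_one _ (hsq x hx.1 hx.2)]
      exact Nat.mul_le_mul h1 h2
    have hM : ∀ x ∈ (T ⊔ Q).normalCore, x ^ 2 ∈ T := fun x hx =>
      hT.normalCore_sup_le h hA hcard hz (hT.sq_mem h hx)
    refine hT.le_of_isPGroup _ inferInstance ?_ (Subgroup.normalCore_le _) hyM
    rintro ⟨x, hx⟩
    refine ⟨2, Subtype.ext ?_⟩
    change x ^ 2 ^ 2 = 1
    rw [pow_two, pow_mul, hT.pow_eq_one _ (hM x hx)]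
  · have hTQ' : ∀ x ∈ T, x ∈ Q → x = 1 := fun x hx hxQ =>
      (hTQ x hx hxQ).resolve_right fun e => hz (e ▸ hx)
    have hpow : ∀ t ∈ T, ∀ q : X, ∀ k : ℕ, (t * q) ^ k ∈ T → q ^ k ∈ T := by
      intro t ht q k hk
      rw [← QuotientGroup.eq_one_iff, QuotientGroup.mk_pow, QuotientGroup.mk_mul,
        (QuotientGroup.eq_one_iff t).2 ht, one_mul, ← QuotientGroup.mk_pow] at hk
      exact (QuotientGroup.eq_one_iff _).1 hk
    have hzM : a ^ n ∉ (T ⊔ Q).normalCore := by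
      intro hzM
      refine hz (hT.mem_of_pow_eq_one h.zpowers_a_le (k := 1) (fun g => ?_) ?_)
      · obtain ⟨t, ht, q, hq, e⟩ := Subgroup.mem_sup_of_normal_left.1 (hzM g)
        have h1 := hpow t ht q 2 (by
          rw [e, conj_pow, h.involution_sq, mul_one, mul_inv_cancel]; exact T.one_mem)
        have hqA : q ∈ Subgroup.zpowers a := by
          obtain rfl | rfl := h.eq_one_or_eq_involution hq (hTQ' _ h1 (Q.pow_mem hq 2))
          · exact Subgroup.one_mem _
          · exact h.involution_mem
        rw [← e]
        exact Subgroup.mul_mem_sup ht hqA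
      · rw [pow_one]; exact h.involution_sq
    obtain ⟨t, ht, q, hq, rfl⟩ := Subgroup.mem_sup_of_normal_left.1 hyT
    have hqM : q ∈ (T ⊔ Q).normalCore :=
      (Subgroup.mul_mem_cancel_left _ (Subgroup.normal_le_normalCore.2 le_sup_left ht)).1 hyM
    have hq2 : q ^ 2 = 1 := hTQ' _ (hpow t ht q 2 (hsq _ hy hyT)) (Q.pow_mem hq 2)
    obtain rfl | rfl := h.eq_one_or_eq_involution hq hq2
    · rwa [mul_one]
    · exact absurd hqM hzM

theorem IsLocalSocle.exists_mul [Finite X] (hT : IsLocalSocle p a Q T) (hp : p.Prime)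
    (h : IsDicyclicFactorization n a b c Q)
    (hA : ∀ x : X, (∀ g : X, g * x * g⁻¹ ∈ Subgroup.zpowers a) → x = 1) {t : X} (ht : t ∈ T) :
    ∃ s ∈ T, s ∈ Subgroup.zpowers a ∧ ∃ y ∈ T, y ∈ Subgroup.zpowers c ∧ t = s * y := by
  have := hT.normal
  obtain ⟨q, hq, y, hy, rfl⟩ := h.exists_mul t
  have hyT : y ∈ T := by
    refine hT.mem_of_mem_sup hp h hA hy ?_
    rw [show y = q⁻¹ * (q * y) by group]
    exact Subgroup.mul_mem _ (Subgroup.inv_mem _ ((le_sup_right : Q ≤ T ⊔ Q) hq))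
      ((le_sup_left : T ≤ T ⊔ Q) ht)
  have hqT := (T.mul_mem_cancel_right hyT).1 ht
  exact ⟨q, hqT, hT.mem_zpowers q hqT hq, y, hyT, hy, rfl⟩

end IsDicyclicFactorization

theorem Subgroup.le_of_forall_eq_mul_zpowers {G : Type*} [Group G] [Finite G] {p : ℕ}
    (hp : p.Prime) {h s s' : G} {T K : Subgroup G} (hKn : K.Normal)
    (hcore : ∀ x : G, (∀ g : G, g * x * g⁻¹ ∈ Subgroup.zpowers h) → x = 1)
    (hTp : ∀ x ∈ T, x ^ p = 1) (hTc : ∀ x ∈ T, ∀ y ∈ T, x * y = y * x) (hTn : T.Normal)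
    (hs : s ∈ T) (hsh : s ∈ Subgroup.zpowers h) (hs1 : s ≠ 1) (hs' : s' ∈ T)
    (hgen : ∀ t ∈ T, ∃ x ∈ Subgroup.zpowers s, ∃ y ∈ Subgroup.zpowers s', t = x * y)
    (hTK : T ≤ K) (hK : ∀ k ∈ K, ∃ t ∈ T, ∃ y ∈ Subgroup.zpowers h, k = t * y) : K ≤ T := by
  have hcomm : ∀ x y : G, x ∈ Subgroup.zpowers h → y ∈ Subgroup.zpowers h → Commute x y := by
    intro x y hx hy
    obtain ⟨i, rfl⟩ := Subgroup.mem_zpowers_iff.1 hx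
    obtain ⟨j, rfl⟩ := Subgroup.mem_zpowers_iff.1 hy
    exact Commute.zpow_zpow_self h i j
  have hsK : ∀ k ∈ K, Commute s k := by
    intro k hk
    obtain ⟨t, ht, y, hy, rfl⟩ := hK k hk
    exact (show Commute s t from hTc s hs t ht).mul_right (hcomm s y hsh hy)
  obtain ⟨g, hg⟩ : ∃ g : G, g * s * g⁻¹ ∉ Subgroup.zpowers h := by
    by_contra! hcon
    exact hs1 (hcore s hcon)
  have huK : ∀ k ∈ K, Commute (g * s * g⁻¹) k := by
    intro k hk
    have := (hsK _ (hKn.conj_mem k hk g⁻¹)).map (MulAut.conj g)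
    simpa [mul_assoc] using this
  obtain ⟨x, hx, v, hv, hu⟩ := hgen _ (hTn.conj_mem s hs g)
  have hxK : ∀ w ∈ Subgroup.zpowers s, ∀ k ∈ K, Commute w k := by
    intro w hw k hk
    obtain ⟨i, rfl⟩ := Subgroup.mem_zpowers_iff.1 hw
    exact (hsK k hk).zpow_left i
  have hvK : ∀ k ∈ K, Commute v k := by
    intro k hk
    have : v = x⁻¹ * (g * s * g⁻¹) := by rw [hu]; group
    rw [this]
    exact (hxK x hx k hk).inv_left.mul_left (huK k hk)
  have hv1 : v ≠ 1 := by
    rintro rfl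
    rw [mul_one] at hu
    exact hg (hu ▸ Subgroup.zpowers_le.2 hsh hx)
  have hs'v : s' ∈ Subgroup.zpowers v := Subgroup.mem_zpowers_of_pow_prime_eq_one hp hv
    (Subgroup.mem_zpowers s') (hTp v (Subgroup.zpowers_le.2 hs' hv)) (hTp s' hs') hv1
  have hTK' : ∀ t ∈ T, ∀ k ∈ K, Commute t k := by
    intro t ht k hk
    obtain ⟨x, hx, y, hy, rfl⟩ := hgen t ht
    refine (hxK x hx k hk).mul_left ?_
    obtain ⟨i, rfl⟩ := Subgroup.mem_zpowers_iff.1 (Subgroup.zpowers_le.2 hs'v hy)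
    exact (hvK k hk).zpow_left i
  intro k hk
  obtain ⟨t, ht, y, hy, rfl⟩ := hK k hk
  have hyK : y ∈ K := (K.mul_mem_cancel_left (hTK ht)).1 hk
  have hyp : y ^ p = 1 := by
    refine hcore _ fun g => ?_
    obtain ⟨t', ht', y', hy', e⟩ := hK _ (hKn.conj_mem y hyK g)
    have hy'K : y' ∈ K := (K.mul_mem_cancel_left (hTK ht')).1 (e ▸ hKn.conj_mem y hyK g)
    rw [← conj_pow, e, (hTK' t' ht' y' hy'K).mul_pow, hTp t' ht', one_mul]
    exact Subgroup.pow_mem _ hy' p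
  exact T.mul_mem ht (Subgroup.zpowers_le.2 hs
    (Subgroup.mem_zpowers_of_pow_prime_eq_one hp hsh hy (hTp s hs) hyp hs1))

namespace IsDicyclicFactorization

variable {X : Type*} [Group X] {n p : ℕ} {a b c : X} {Q T : Subgroup X}

theorem IsLocalSocle.exists_mem_zpowers_left [Finite X] (hT : IsLocalSocle p a Q T) (hp : p.Prime)
    (h : IsDicyclicFactorization n a b c Q)
    (hA : ∀ x : X, (∀ g : X, g * x * g⁻¹ ∈ Subgroup.zpowers a) → x = 1)
    (hC : ∀ x : X, (∀ g : X, g * x * g⁻¹ ∈ Subgroup.zpowers c) → x = 1) :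
    ∃ s ∈ T, s ∈ Subgroup.zpowers a ∧ s ≠ 1 := by
  by_contra! hcon
  refine hT.ne_bot ((Subgroup.eq_bot_iff_forall _).2 fun t ht => hC t fun g => ?_)
  obtain ⟨s, hs, hsa, y, -, hy, e⟩ := hT.exists_mul hp h hA (hT.normal.conj_mem t ht g)
  rwa [e, hcon s hs hsa, one_mul]

theorem IsLocalSocle.exists_mem_zpowers_right [Finite X] (hT : IsLocalSocle p a Q T)
    (hp : p.Prime) (h : IsDicyclicFactorization n a b c Q)
    (hA : ∀ x : X, (∀ g : X, g * x * g⁻¹ ∈ Subgroup.zpowers a) → x = 1) :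
    ∃ y ∈ T, y ∈ Subgroup.zpowers c ∧ y ≠ 1 := by
  by_contra! hcon
  refine hT.ne_bot ((Subgroup.eq_bot_iff_forall _).2 fun t ht => hA t fun g => ?_)
  obtain ⟨s, hs, hsa, y, hyT, hy, e⟩ := hT.exists_mul hp h hA (hT.normal.conj_mem t ht g)
  rwa [e, hcon y hyT hy, mul_one]

theorem not_isLocalSocle_two [Finite X] (h : IsDicyclicFactorization n a b c Q)
    (hA : ∀ x : X, (∀ g : X, g * x * g⁻¹ ∈ Subgroup.zpowers a) → x = 1)
    (hC : ∀ x : X, (∀ g : X, g * x * g⁻¹ ∈ Subgroup.zpowers c) → x = 1) :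
    ¬ IsLocalSocle 2 a Q T := by
  intro hT
  have hsz : ∀ s ∈ T, s ∈ Subgroup.zpowers a → s = 1 ∨ s = a ^ n := fun s hs hsa =>
    h.eq_one_or_eq_involution (h.zpowers_a_le hsa) (hT.pow_eq_one s hs)
  have hzT : a ^ n ∈ T := by
    obtain ⟨s, hs, hsa, hs1⟩ := hT.exists_mem_zpowers_left Nat.prime_two h hA hC
    exact (hsz s hs hsa).resolve_left hs1 ▸ hs
  have hzQ : a ^ n ∈ Q := h.zpowers_a_le h.involution_mem
  obtain ⟨s, hs, hsa, y, hyT, hy, e⟩ :=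
    hT.exists_mul Nat.prime_two h hA (hT.normal.conj_mem _ hzT c)
  have hy1 : y ≠ 1 := by
    rintro rfl
    rw [mul_one] at e
    have hzc : Commute c (a ^ n) := by
      obtain rfl | rfl := hsz s hs hsa
      · exact absurd (conj_eq_one_iff.1 e) h.involution_ne_one
      · exact mul_inv_eq_iff_eq_mul.1 e
    refine h.involution_ne_one (hA _ fun g => ?_)
    obtain ⟨q, hq, w, hw, rfl⟩ := h.exists_mul g
    obtain ⟨i, rfl⟩ := Subgroup.mem_zpowers_iff.1 hw
    have : q * c ^ i * a ^ n * (q * c ^ i)⁻¹ = q * a ^ n * q⁻¹ := by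
      calc _ = q * (c ^ i * a ^ n) * (c ^ i)⁻¹ * q⁻¹ := by group
        _ = q * a ^ n * q⁻¹ := by rw [(hzc.zpow_left i).eq]; group
    rw [this, h.involution_comm hq]
    exact h.involution_mem
  obtain rfl | rfl := hsz s hs hsa
  · refine hy1 (h.eq_one_of_conj_mem (g := c⁻¹) hy ?_)
    rw [← one_mul y, ← e]
    simpa [mul_assoc] using hzQ
  obtain ⟨g, hg⟩ : ∃ g : X, g * y * g⁻¹ ∉ Subgroup.zpowers c := by
    by_contra! hcon
    exact hy1 (hC y hcon)
  obtain ⟨s, hs, hsa, w, hwT, hw, e'⟩ :=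
    hT.exists_mul Nat.prime_two h hA (hT.normal.conj_mem _ hyT g)
  obtain rfl | rfl := hsz s hs hsa
  · rw [one_mul] at e'
    exact hg (e' ▸ hw)
  have hyy : y ^ (2 : ℤ) = 1 := by exact_mod_cast hT.pow_eq_one y hyT
  obtain ⟨i, rfl⟩ := Subgroup.mem_zpowers_iff.1 (Subgroup.mem_zpowers_of_pow_prime_eq_one
    Nat.prime_two hy hw (hT.pow_eq_one y hyT) (hT.pow_eq_one w hwT) hy1)
  obtain ⟨k, rfl | rfl⟩ := Int.even_or_odd' i
  · rw [zpow_mul, hyy, one_zpow, mul_one] at e'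
    exact hy1 (h.eq_one_of_conj_mem (g := g) hy (e' ▸ hzQ))
  · rw [zpow_add, zpow_mul, hyy, one_zpow, one_mul, zpow_one, ← e] at e'
    refine hy1 (h.eq_one_of_conj_mem (g := c⁻¹ * g) hy ?_)
    have : c⁻¹ * g * y * (c⁻¹ * g)⁻¹ = c⁻¹ * (g * y * g⁻¹) * c := by group
    rw [this, e']
    simpa [mul_assoc] using hzQ

theorem IsLocalSocle.exists_quotient [Finite X] (hT : IsLocalSocle p a Q T) (hp : p.Prime)
    (hodd : Odd p) (h : IsDicyclicFactorization n a b c Q)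
    (hA : ∀ x : X, (∀ g : X, g * x * g⁻¹ ∈ Subgroup.zpowers a) → x = 1)
    (hC : ∀ x : X, (∀ g : X, g * x * g⁻¹ ∈ Subgroup.zpowers c) → x = 1) [T.Normal] :
    ∃ n' : ℕ, IsDicyclicFactorization n' (a : X ⧸ T) (b : X ⧸ T) (c : X ⧸ T)
      (Q.map (QuotientGroup.mk' T)) := by
  obtain ⟨s, hs, hsa, hs1⟩ := hT.exists_mem_zpowers_left hp h hA hC
  have hpn : p ∣ n := by
    have := Fact.mk hp
    have hd : orderOf s ∣ Nat.card (Subgroup.zpowers a) := Subgroup.orderOf_dvd_natCard _ hsa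
    rw [orderOf_eq_prime (hT.pow_eq_one s hs) hs1, Nat.card_zpowers, h.orderOf_a] at hd
    refine (Nat.Coprime.dvd_of_dvd_mul_left ?_ hd)
    exact hodd.coprime_two_right
  obtain ⟨m, rfl⟩ := hpn
  have hm : 0 < m := Nat.pos_of_mul_pos_left h.pos
  have key : ∀ k : ℕ, (a : X ⧸ T) ^ k = 1 ↔ 2 * m ∣ k := by
    intro k
    have h1 : (a : X ⧸ T) ^ k = 1 ↔ a ^ k ∈ T := QuotientGroup.eq_one_iff (a ^ k)
    have h2 : a ^ k ∈ T ↔ (a ^ k) ^ p = 1 := ⟨hT.pow_eq_one _, fun hk =>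
      Subgroup.zpowers_le.2 hs (Subgroup.mem_zpowers_of_pow_prime_eq_one hp hsa
        (Subgroup.npow_mem_zpowers a k) (hT.pow_eq_one s hs) hk hs1)⟩
    rw [h1, h2, ← pow_mul, ← orderOf_dvd_iff_pow_eq_one, h.orderOf_a,
      show 2 * (p * m) = 2 * m * p by ring]
    exact Nat.mul_dvd_mul_iff_right hp.pos
  refine ⟨m, hm, Subgroup.mem_map_of_mem _ h.a_mem, Subgroup.mem_map_of_mem _ h.b_mem, ?_,
    Nat.dvd_antisymm (orderOf_dvd_of_pow_eq_one ((key _).2 dvd_rfl))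
      ((key _).1 (pow_orderOf_eq_one _)), ?_, ?_, ?_, ?_, ?_⟩
  · rintro _ ⟨x, hx, rfl⟩
    obtain hx | ⟨y, hy, rfl⟩ := h.mem_or x hx
    · obtain ⟨i, rfl⟩ := Subgroup.mem_zpowers_iff.1 hx
      exact Or.inl ⟨i, rfl⟩
    · obtain ⟨i, rfl⟩ := Subgroup.mem_zpowers_iff.1 hy
      exact Or.inr ⟨(a : X ⧸ T) ^ i, ⟨i, rfl⟩, rfl⟩
  · have e : (b : X ⧸ T) ^ 2 = (a : X ⧸ T) ^ (p * m) :=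
      congrArg (QuotientGroup.mk (s := T)) h.sq_b
    obtain ⟨r, rfl⟩ := hodd
    rw [e, show (2 * r + 1) * m = 2 * m * r + m by ring, pow_add, pow_mul, (key _).2 dvd_rfl,
      one_pow, one_mul]
  · exact congrArg (QuotientGroup.mk (s := T)) h.conj_a
  · rintro ⟨i, hi⟩
    have hi : ((a ^ i : X) : X ⧸ T) = b := hi
    rw [QuotientGroup.eq] at hi
    have hai := Subgroup.zpow_mem_zpowers a i
    have := hT.mem_zpowers _ hi (Q.mul_mem (Q.inv_mem (h.zpowers_a_le hai)) h.b_mem)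
    exact h.b_notMem ((Subgroup.mul_mem_cancel_left _ (Subgroup.inv_mem _ hai)).1 this)
  · rintro _ ⟨q, hq, rfl⟩ ⟨i, hi⟩
    have hi : ((c ^ i : X) : X ⧸ T) = (q : X ⧸ T) := hi
    have hi' := QuotientGroup.eq.1 hi.symm
    obtain ⟨s, hs, hsa, y, hyT, hy, e⟩ := hT.exists_mul hp h hA hi'
    have e' : q * s = c ^ i * y⁻¹ := by
      rw [eq_mul_inv_iff_mul_eq, mul_assoc, ← e]; group
    have := h.eq_one (q * s) (Q.mul_mem hq (h.zpowers_a_le hsa))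
      (e' ▸ Subgroup.mul_mem _ (Subgroup.zpow_mem_zpowers c i) (Subgroup.inv_mem _ hy))
    refine (QuotientGroup.eq_one_iff q).2 ?_
    rw [eq_inv_of_mul_eq_one_left this]
    exact T.inv_mem hs
  · intro x
    obtain ⟨x, rfl⟩ := QuotientGroup.mk_surjective x
    obtain ⟨q, hq, y, hy, rfl⟩ := h.exists_mul x
    obtain ⟨i, rfl⟩ := Subgroup.mem_zpowers_iff.1 hy
    exact ⟨q, Subgroup.mem_map_of_mem _ hq, (c : X ⧸ T) ^ i, ⟨i, rfl⟩, rfl⟩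

/-- If the core of `⟨h⟩` is trivial, so is the core of its image modulo `T`. -/
theorem eq_one_of_forall_conj_mem_zpowers_mk {G : Type*} [Group G] [Finite G] {p : ℕ}
    (hp : p.Prime) {h s s' : G} {T : Subgroup G} [hTn : T.Normal]
    (hcore : ∀ x : G, (∀ g : G, g * x * g⁻¹ ∈ Subgroup.zpowers h) → x = 1)
    (hTp : ∀ x ∈ T, x ^ p = 1) (hTc : ∀ x ∈ T, ∀ y ∈ T, x * y = y * x)
    (hs : s ∈ T) (hsh : s ∈ Subgroup.zpowers h) (hs1 : s ≠ 1) (hs' : s' ∈ T)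
    (hgen : ∀ t ∈ T, ∃ x ∈ Subgroup.zpowers s, ∃ y ∈ Subgroup.zpowers s', t = x * y)
    (x : G ⧸ T) (hx : ∀ g : G ⧸ T, g * x * g⁻¹ ∈ Subgroup.zpowers (h : G ⧸ T)) : x = 1 := by
  obtain ⟨x, rfl⟩ := QuotientGroup.mk_surjective x
  have hTK : T ≤ (Subgroup.zpowers (h : G ⧸ T)).normalCore.comap (QuotientGroup.mk' T) :=
    fun t ht => by
      rw [Subgroup.mem_comap, QuotientGroup.mk'_apply, (QuotientGroup.eq_one_iff t).2 ht]
      exact Subgroup.one_mem _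
  refine (QuotientGroup.eq_one_iff x).2 (Subgroup.le_of_forall_eq_mul_zpowers hp
    (Subgroup.Normal.comap inferInstance (QuotientGroup.mk' T)) hcore hTp hTc hTn hs hsh hs1 hs'
    hgen hTK (fun k hk => ?_) (show x ∈ _ from hx))
  obtain ⟨i, hi⟩ := Subgroup.normalCore_le _ (Subgroup.mem_comap.1 hk)
  have hi : ((h ^ i : G) : G ⧸ T) = (k : G ⧸ T) := hi
  have := QuotientGroup.eq.1 hi
  exact ⟨h ^ i * ((h ^ i)⁻¹ * k) * (h ^ i)⁻¹, hTn.conj_mem _ this _, h ^ i,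
    Subgroup.zpow_mem_zpowers h i, by group⟩

end IsDicyclicFactorization

theorem IsDicyclicFactorization.exists_forall_conj_mem_zpowers.{u} (m : ℕ) :
    ∀ {X : Type u} [Group X] [Finite X] (n : ℕ) (a b c : X) (Q : Subgroup X), Nat.card X = m →
      IsDicyclicFactorization n a b c Q →
      (∀ x : X, (∀ g : X, g * x * g⁻¹ ∈ Subgroup.zpowers c) → x = 1) →
      ∃ x : X, (∀ g : X, g * x * g⁻¹ ∈ Subgroup.zpowers a) ∧ x ≠ 1 := by
  induction m using Nat.strong_induction_on with
  | _ m ih =>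
  intro X _ _ n a b c Q hm h hC
  by_contra! hA
  obtain ⟨p, hp, P, hPn, hP, hP1⟩ := h.exists_normal_isPGroup
  obtain ⟨E, hEn, hE, hEp, hEc⟩ := exists_normal_pow_eq_one_of_isPGroup hp hPn hP hP1
  obtain ⟨T, hT⟩ := h.exists_isLocalSocle hA hp hEn hE hEp hEc
  obtain rfl | hodd := hp.eq_two_or_odd'
  · exact h.not_isLocalSocle_two hA hC hT
  have hn := hT.normal
  obtain ⟨s, hs, hsa, hs1⟩ := hT.exists_mem_zpowers_left hp h hA hC
  obtain ⟨d, hd, hdc, hd1⟩ := hT.exists_mem_zpowers_right hp h hA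
  have hgen : ∀ t ∈ T, ∃ x ∈ Subgroup.zpowers s, ∃ y ∈ Subgroup.zpowers d, t = x * y := by
    intro t ht
    obtain ⟨x, hx, hxa, y, hy, hyc, e⟩ := hT.exists_mul hp h hA ht
    exact ⟨x, Subgroup.mem_zpowers_of_pow_prime_eq_one hp hsa hxa (hT.pow_eq_one s hs)
      (hT.pow_eq_one x hx) hs1, y, Subgroup.mem_zpowers_of_pow_prime_eq_one hp hdc hyc
      (hT.pow_eq_one d hd) (hT.pow_eq_one y hy) hd1, e⟩
  have hgen' : ∀ t ∈ T, ∃ x ∈ Subgroup.zpowers d, ∃ y ∈ Subgroup.zpowers s, t = x * y := by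
    intro t ht
    obtain ⟨x, hx, y, hy, e⟩ := hgen t ht
    exact ⟨y, hy, x, hx, by rw [e, hT.comm _ (Subgroup.zpowers_le.2 hs hx) _
      (Subgroup.zpowers_le.2 hd hy)]⟩
  obtain ⟨n', hn'⟩ := hT.exists_quotient hp hodd h hA hC
  have hlt : Nat.card (X ⧸ T) < m := by
    have h1 := (Subgroup.one_lt_card_iff_ne_bot T).2 hT.ne_bot
    have h2 := Subgroup.card_eq_card_quotient_mul_card_subgroup T
    have h3 : 0 < Nat.card (X ⧸ T) := Nat.card_pos
    rw [← hm, h2]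
    exact (Nat.lt_mul_iff_one_lt_right h3).2 h1
  obtain ⟨x, hx, hx1⟩ := ih _ hlt n' _ _ _ _ rfl hn'
    (eq_one_of_forall_conj_mem_zpowers_mk hp hC hT.pow_eq_one hT.comm hd hdc hd1 hs hgen')
  exact hx1 (eq_one_of_forall_conj_mem_zpowers_mk hp hA hT.pow_eq_one hT.comm hs hsa hs1 hd hgen
    x hx)

/-- If `X = Q⟨c⟩` with `Q` generalized quaternion, `Q ∩ ⟨c⟩ = 1` and the core of `⟨c⟩`
in `X` is trivial, then the core of `⟨a⟩` in `X` is nontrivial. -/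
theorem normalCore_zpowers_a_ne_bot {X : Type*} [Group X] [Finite X]
    (n : ℕ) (hn : 2 ≤ n) (a b c : X)
    (Q : Subgroup X) (hQgen : Q = Subgroup.closure {a, b})
    (hoa : orderOf a = 2 * n) (hb2 : b ^ 2 = a ^ n)
    (hrel : b * a * b⁻¹ = a⁻¹) (hcardQ : Nat.card Q = 4 * n)
    (hint : Q ⊓ Subgroup.zpowers c = ⊥)
    (hfact : ∀ x : X, ∃ g ∈ Q, ∃ k : ℤ, x = g * c ^ k)
    (hcore : (Subgroup.zpowers c).normalCore = ⊥) :
    (Subgroup.zpowers a).normalCore ≠ ⊥ := by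
  have haQ : a ∈ Q := hQgen ▸ Subgroup.subset_closure (by simp)
  have hbQ : b ∈ Q := hQgen ▸ Subgroup.subset_closure (by simp)
  have hle : Subgroup.zpowers a ≤ Q := Subgroup.zpowers_le.2 haQ
  have hbA : b ∉ Subgroup.zpowers a := by
    intro hb
    have : Q ≤ Subgroup.zpowers a := by
      rw [hQgen, Subgroup.closure_le]
      rintro x (rfl | rfl)
      · exact Subgroup.mem_zpowers x
      · exact hb
    have := Subgroup.card_le_of_le this
    rw [hcardQ, Nat.card_zpowers, hoa] at this
    omega
  have hind : ((Subgroup.zpowers a).subgroupOf Q).index = 2 := by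
    have := ((Subgroup.zpowers a).subgroupOf Q).card_mul_index
    rw [Nat.card_congr (Subgroup.subgroupOfEquivOfLe hle).toEquiv, Nat.card_zpowers, hoa,
      hcardQ] at this
    have h0 : 0 < 2 * n := by omega
    exact Nat.eq_of_mul_eq_mul_left h0 (by omega)
  have h : IsDicyclicFactorization n a b c Q :=
    { pos := by omega
      a_mem := haQ
      b_mem := hbQ
      mem_or := by
        intro x hx
        refine or_iff_not_imp_left.2 fun hxA => ⟨b⁻¹ * x, ?_, by group⟩
        have := Subgroup.mul_mem_iff_of_index_two hind (a := ⟨b, hbQ⟩⁻¹) (b := ⟨x, hx⟩)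
        rw [inv_mem_iff] at this
        exact this.2 (iff_of_false hbA hxA)
      orderOf_a := hoa
      sq_b := hb2
      conj_a := hrel
      b_notMem := hbA
      eq_one := fun x hx hxc => by
        rw [← Subgroup.mem_bot, ← hint]
        exact ⟨hx, hxc⟩
      exists_mul := fun x => by
        obtain ⟨g, hg, k, e⟩ := hfact x
        exact ⟨g, hg, c ^ k, Subgroup.zpow_mem_zpowers c k, e⟩ }
  intro hbot
  obtain ⟨x, hx, hx1⟩ := IsDicyclicFactorization.exists_forall_conj_mem_zpowers _ n a b c Q rfl h
    fun x hx => by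
      rw [← Subgroup.mem_bot, ← hcore]
      exact hx
  refine hx1 ?_
  rw [← Subgroup.mem_bot, ← hbot]
  exact hx
end

section
/- Let G = AB ≠ 1 be a finite group with A and B abelian subgroups. Then A or B contains a nontrivial normal subgroup of G. -/
open scoped commutatorElement

/-- Commuting nilpotent endomorphisms of a finite nontrivial additive group have a common
nonzero kernel element. -/
theorem exists_ne_zero_forall_apply_eq_zero_of_isNilpotent {V ι : Type*} [AddCommGroup V]
    [Finite V] [Nontrivial V] (φ : ι → AddMonoid.End V) (hcomm : ∀ i j, Commute (φ i) (φ j))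
    (hnil : ∀ i, IsNilpotent (φ i)) : ∃ v : V, v ≠ 0 ∧ ∀ i, φ i v = 0 := by
  obtain ⟨W, ⟨hW, hinv⟩, hmin⟩ := (Set.toFinite
    {W : AddSubgroup V | W ≠ ⊥ ∧ ∀ i, ∀ w ∈ W, φ i w ∈ W}).exists_minimal
      ⟨⊤, top_ne_bot, fun _ _ _ => trivial⟩
  have hker (i : ι) (w : V) (hw : w ∈ W) : φ i w = 0 := by
    suffices h : W ≤ W ⊓ (φ i).ker from (h hw).2
    refine hmin ⟨?_, fun j w hw => ⟨hinv j w hw.1, ?_⟩⟩ inf_le_left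
    · intro hbot
      have hinj (v : V) (hv : v ∈ W) (h : φ i v = 0) : v = 0 := by
        have : v ∈ W ⊓ (φ i).ker := ⟨hv, h⟩
        rwa [hbot] at this
      have hpow (n : ℕ) : ∀ v ∈ W, (φ i ^ n) v = 0 → v = 0 := by
        induction n with
        | zero => exact fun v _ h => h
        | succ n ih =>
          intro v hv h
          rw [pow_succ] at h
          exact hinj v hv (ih _ (hinv i v hv) h)
      obtain ⟨n, hn⟩ := hnil i
      refine hW (W.eq_bot_iff_forall.2 fun v hv => hpow n v hv ?_)
      rw [hn]
      rfl
    · have h : φ i w = 0 := hw.2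
      change φ i (φ j w) = 0
      have := DFunLike.congr_fun (hcomm i j) w
      change φ i (φ j w) = φ j (φ i w) at this
      rw [this, h, map_zero]
  obtain ⟨w, hw, hw0⟩ := W.bot_or_exists_ne_zero.resolve_left hW
  exact ⟨w, hw0, fun i => hker i w hw⟩

/-- If commuting injective endomorphisms of a finite additive group admit a surjective
crossed homomorphism, then each of them is unipotent. -/
theorem isNilpotent_sub_one_of_surjective_crossed {V ι : Type*} [AddCommGroup V] [Finite V]
    (ρ : ι → AddMonoid.End V) (hcomm : ∀ i j, Commute (ρ i) (ρ j))
    (hinj : ∀ i, Function.Injective (ρ i)) (δ : ι → V) (hδ : Function.Surjective δ)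
    (hsymm : ∀ i j, δ i + ρ i (δ j) = δ j + ρ j (δ i)) (i : ι) : IsNilpotent (ρ i - 1) := by
  have : Finite (AddMonoid.End V) := DFunLike.finite _
  set φ : ι → AddMonoid.End V := fun j => ρ j - 1
  have hφcomm (j k : ι) : Commute (φ j) (φ k) :=
    ((hcomm j k).sub_left (Commute.one_left _)).sub_right (Commute.one_right _)
  have hφsymm (j k : ι) : φ j (δ k) = φ k (δ j) := by
    change ρ j (δ k) - δ k = ρ k (δ j) - δ j
    rw [sub_eq_sub_iff_add_eq_add, add_comm, hsymm, add_comm]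
  obtain ⟨m, n, hmn, hpow⟩ : ∃ m n : ℕ, m < n ∧ φ i ^ m = φ i ^ n := by
    obtain ⟨m, n, hne, h⟩ := Finite.exists_ne_map_eq_of_infinite (fun n : ℕ => φ i ^ n)
    rcases hne.lt_or_gt with hlt | hlt
    · exact ⟨m, n, hlt, h⟩
    · exact ⟨n, m, hlt, h.symm⟩
  obtain ⟨k, rfl⟩ := Nat.exists_eq_add_of_lt hmn
  have hcycle (v : V) : (φ i ^ k) (φ i ((φ i ^ m) v)) = (φ i ^ m) v := by
    conv_rhs => rw [hpow, add_assoc, add_comm, pow_add, pow_succ]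
    rfl
  have hcancel (v : V) (hv : φ i ((φ i ^ m) v) = 0) : (φ i ^ m) v = 0 := by
    rw [← hcycle, hv, map_zero]
  have swap (f g : AddMonoid.End V) (h : Commute f g) (v : V) : f (g v) = g (f v) :=
    DFunLike.congr_fun h v
  -- `u` satisfies `φ i ((φ i ^ m) u) = (φ i ^ m) (δ i)`
  set u : V := (φ i ^ k) (δ i)
  have hu (j : ι) : (φ i ^ m) (δ j) = φ j ((φ i ^ m) u) := by
    have hui : φ i ((φ i ^ m) u) = (φ i ^ m) (δ i) := by
      rw [swap _ _ ((Commute.refl (φ i)).pow_pow m k), swap _ _ ((Commute.refl (φ i)).pow_right k),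
        hcycle]
    have h := hcancel (δ j - φ j u) ?_
    · rw [map_sub, sub_eq_zero] at h
      rw [h, swap _ _ ((hφcomm i j).pow_left m)]
    · rw [map_sub, map_sub, sub_eq_zero, swap _ _ ((Commute.refl (φ i)).pow_right m), hφsymm,
        swap _ _ ((hφcomm i j).pow_left m), ← hui, swap _ _ ((hφcomm i j).pow_left m),
        swap _ _ (hφcomm i j)]
  obtain ⟨j, hj⟩ := hδ (-u)
  have hzero : (φ i ^ m) u = 0 := by
    apply hinj j
    have h := hu j
    change (φ i ^ m) (δ j) = ρ j ((φ i ^ m) u) - (φ i ^ m) u at h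
    rw [hj, map_neg, eq_comm, sub_eq_neg_self] at h
    rw [h, map_zero]
  refine ⟨m, AddMonoidHom.ext fun v => ?_⟩
  obtain ⟨j, rfl⟩ := hδ v
  exact (hu j).trans (by rw [hzero, map_zero]; rfl)

section Factorization

variable {G : Type*} [Group G] {A B : Subgroup G}

theorem exists_eq_mul_swap (hfact : ∀ g : G, ∃ a ∈ A, ∃ b ∈ B, g = a * b) (g : G) :
    ∃ b ∈ B, ∃ a ∈ A, g = b * a := by
  obtain ⟨a, ha, b, hb, h⟩ := hfact g⁻¹
  exact ⟨b⁻¹, B.inv_mem hb, a⁻¹, A.inv_mem ha, by rw [← mul_inv_rev, ← h, inv_inv]⟩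

theorem eq_one_of_forall_commute_of_normalCore_eq_bot (hcore : A.normalCore = ⊥) {a : G}
    (ha : a ∈ A) (hcent : ∀ g : G, g * a = a * g) : a = 1 := by
  rw [← Subgroup.mem_bot, ← hcore]
  intro g
  rwa [hcent, mul_inv_cancel_right]

theorem eq_one_of_commute_left_factor (hfact : ∀ g : G, ∃ a ∈ A, ∃ b ∈ B, g = a * b)
    (hB : ∀ x ∈ B, ∀ y ∈ B, x * y = y * x) (hcore : B.normalCore = ⊥) {b : G}
    (hb : b ∈ B) (hbA : ∀ a ∈ A, a * b = b * a) : b = 1 := by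
  refine eq_one_of_forall_commute_of_normalCore_eq_bot hcore hb fun g => ?_
  obtain ⟨a, ha, b', hb', rfl⟩ := hfact g
  rw [mul_assoc, hB b' hb' b hb, ← mul_assoc, hbA a ha, mul_assoc]

/-- The two ways of conjugating a commutator of `A` and `B` by an element of `A` and an element of
`B` agree, and give again such a commutator. -/
theorem conj_commutatorElement_of_mul_abelian (hA : ∀ x ∈ A, ∀ y ∈ A, x * y = y * x)
    (hB : ∀ x ∈ B, ∀ y ∈ B, x * y = y * x)
    (hfact : ∀ g : G, ∃ a ∈ A, ∃ b ∈ B, g = a * b) {a b a₁ b₁ : G}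
    (ha : a ∈ A) (hb : b ∈ B) (ha₁ : a₁ ∈ A) (hb₁ : b₁ ∈ B) :
    ∃ a' ∈ A, ∃ b' ∈ B, a₁ * b₁ * ⁅a, b⁆ * (a₁ * b₁)⁻¹ = ⁅a', b'⁆ ∧
      b₁ * a₁ * ⁅a, b⁆ * (b₁ * a₁)⁻¹ = ⁅a', b'⁆ := by
  obtain ⟨a', ha', d, hd, hx⟩ := hfact (b₁ * a * b₁⁻¹)
  obtain ⟨b', hb', c, hc, hy⟩ := exists_eq_mul_swap hfact (a₁ * b * a₁⁻¹)
  have left (y : G) (hy : y ∈ B) : b₁ * ⁅a, y⁆ * b₁⁻¹ = ⁅a', y⁆ := by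
    have h : b₁ * y * b₁⁻¹ = y := by rw [hB b₁ hb₁ y hy, mul_inv_cancel_right]
    have h' : d * y * d⁻¹ = y := by rw [hB d hd y hy, mul_inv_cancel_right]
    calc b₁ * ⁅a, y⁆ * b₁⁻¹
        = (b₁ * a * b₁⁻¹) * (b₁ * y * b₁⁻¹) * (b₁ * a * b₁⁻¹)⁻¹ * (b₁ * y * b₁⁻¹)⁻¹ := by
          simp only [commutatorElement_def]; group
      _ = a' * (d * y * d⁻¹) * a'⁻¹ * y⁻¹ := by rw [hx, h]; group
      _ = ⁅a', y⁆ := by rw [h']; rfl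
  have right (x : G) (hx : x ∈ A) : a₁ * ⁅x, b⁆ * a₁⁻¹ = ⁅x, b'⁆ := by
    have h : a₁ * x * a₁⁻¹ = x := by rw [hA a₁ ha₁ x hx, mul_inv_cancel_right]
    have h' : c * x⁻¹ * c⁻¹ = x⁻¹ := by rw [hA c hc _ (A.inv_mem hx), mul_inv_cancel_right]
    calc a₁ * ⁅x, b⁆ * a₁⁻¹
        = (a₁ * x * a₁⁻¹) * (a₁ * b * a₁⁻¹) * (a₁ * x * a₁⁻¹)⁻¹ * (a₁ * b * a₁⁻¹)⁻¹ := by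
          simp only [commutatorElement_def]; group
      _ = x * b' * (c * x⁻¹ * c⁻¹) * b'⁻¹ := by rw [hy, h]; group
      _ = ⁅x, b'⁆ := by rw [h']; rfl
  refine ⟨a', ha', b', hb', ?_, ?_⟩
  · rw [← right a' ha', ← left b hb]; group
  · rw [← left b' hb', ← right a ha]; group

/-- Itô: the commutators of two abelian factors commute with each other. -/
theorem commute_commutatorElement_of_mul_abelian (hA : ∀ x ∈ A, ∀ y ∈ A, x * y = y * x)
    (hB : ∀ x ∈ B, ∀ y ∈ B, x * y = y * x)
    (hfact : ∀ g : G, ∃ a ∈ A, ∃ b ∈ B, g = a * b) {a b a₁ b₁ : G}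
    (ha : a ∈ A) (hb : b ∈ B) (ha₁ : a₁ ∈ A) (hb₁ : b₁ ∈ B) :
    ⁅a₁, b₁⁆ * ⁅a, b⁆ = ⁅a, b⁆ * ⁅a₁, b₁⁆ := by
  obtain ⟨a', -, b', -, h, h'⟩ := conj_commutatorElement_of_mul_abelian hA hB hfact ha hb
    (A.inv_mem ha₁) (B.inv_mem hb₁)
  rw [← h'] at h
  rw [← mul_inv_eq_iff_eq_mul]
  calc ⁅a₁, b₁⁆ * ⁅a, b⁆ * ⁅a₁, b₁⁆⁻¹
      = (b₁⁻¹ * a₁⁻¹)⁻¹ * (a₁⁻¹ * b₁⁻¹ * ⁅a, b⁆ * (a₁⁻¹ * b₁⁻¹)⁻¹) * (b₁⁻¹ * a₁⁻¹) := by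
        simp only [commutatorElement_def a₁ b₁]; group
    _ = ⁅a, b⁆ := by rw [h]; group

/-- Itô: a product of two abelian subgroups has an abelian normal subgroup modulo which
the factors commute. -/
theorem exists_normal_abelian_of_mul_abelian (hA : ∀ x ∈ A, ∀ y ∈ A, x * y = y * x)
    (hB : ∀ x ∈ B, ∀ y ∈ B, x * y = y * x)
    (hfact : ∀ g : G, ∃ a ∈ A, ∃ b ∈ B, g = a * b) :
    ∃ N : Subgroup G, N.Normal ∧ (∀ x ∈ N, ∀ y ∈ N, x * y = y * x) ∧
      ∀ a ∈ A, ∀ b ∈ B, ⁅a, b⁆ ∈ N := by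
  set S : Set G := {g | ∃ a ∈ A, ∃ b ∈ B, ⁅a, b⁆ = g}
  refine ⟨Subgroup.closure S, ?_, ?_, fun a ha b hb => Subgroup.subset_closure ⟨a, ha, b, hb, rfl⟩⟩
  · refine ⟨fun n hn g => ?_⟩
    suffices h : Subgroup.closure S ≤ (Subgroup.closure S).comap (MulAut.conj g).toMonoidHom from
      h hn
    rw [Subgroup.closure_le]
    rintro _ ⟨a, ha, b, hb, rfl⟩
    obtain ⟨a₁, ha₁, b₁, hb₁, rfl⟩ := hfact g
    obtain ⟨a', ha', b', hb', h, -⟩ :=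
      conj_commutatorElement_of_mul_abelian hA hB hfact ha hb ha₁ hb₁
    exact Subgroup.subset_closure ⟨a', ha', b', hb', h.symm⟩
  · have hcomm : ∀ x ∈ S, ∀ y ∈ S, x * y = y * x := by
      rintro _ ⟨a₁, ha₁, b₁, hb₁, rfl⟩ _ ⟨a, ha, b, hb, rfl⟩
      exact commute_commutatorElement_of_mul_abelian hA hB hfact ha hb ha₁ hb₁
    have h₁ : Subgroup.closure S ≤ Subgroup.centralizer S :=
      (Subgroup.closure_le _).2 fun x hx => Subgroup.mem_centralizer_iff.2 fun y hy => hcomm y hy x hx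
    have h₂ : Subgroup.closure S ≤ Subgroup.centralizer (Subgroup.closure S : Set G) :=
      Subgroup.le_centralizer_iff.1 ((Subgroup.centralizer_closure S).symm ▸ h₁)
    exact fun x hx y hy => Subgroup.mem_centralizer_iff.1 (h₂ hy) x hx

theorem eq_one_of_mem_of_commute_normal (hA : ∀ x ∈ A, ∀ y ∈ A, x * y = y * x)
    (hB : ∀ x ∈ B, ∀ y ∈ B, x * y = y * x)
    (hfact : ∀ g : G, ∃ a ∈ A, ∃ b ∈ B, g = a * b)
    (hAcore : A.normalCore = ⊥) (hBcore : B.normalCore = ⊥) {N : Subgroup G}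
    (hAB : ∀ a ∈ A, ∀ b ∈ B, ⁅a, b⁆ ∈ N) {a : G} (ha : a ∈ A)
    (haN : ∀ n ∈ N, n * a = a * n) : a = 1 := by
  rw [← Subgroup.mem_bot, ← hAcore]
  intro g
  have hconj (x : G) (hx : x ∈ A) : x * (g * a * g⁻¹) = g * a * g⁻¹ * x := by
    obtain ⟨c, hc, b, hb, rfl⟩ := hfact g
    have h₁ : b⁻¹ * x * b * a = a * (b⁻¹ * x * b) := by
      have h₂ : b⁻¹ * x * b = x * ⁅x⁻¹, b⁻¹⁆ := by rw [commutatorElement_def]; group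
      rw [h₂, mul_assoc, haN _ (hAB _ (A.inv_mem hx) _ (B.inv_mem hb)), ← mul_assoc, hA x hx a ha,
        mul_assoc]
    have h₃ : c⁻¹ * x * c = x := by
      rw [mul_assoc, hA x hx c hc, inv_mul_cancel_left]
    calc x * (c * b * a * (c * b)⁻¹)
        = c * b * (b⁻¹ * (c⁻¹ * x * c) * b * a) * (c * b)⁻¹ := by group
      _ = c * b * a * (b⁻¹ * (c⁻¹ * x * c) * b) * (c * b)⁻¹ := by rw [h₃, h₁]; group
      _ = c * b * a * (c * b)⁻¹ * x := by group
  obtain ⟨c, hc, b, hb, h⟩ := hfact (g * a * g⁻¹)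
  have hb1 : b = 1 := by
    refine eq_one_of_commute_left_factor hfact hB hBcore hb fun x hx => ?_
    have h' := hconj x hx
    rw [h, ← mul_assoc, hA x hx c hc, mul_assoc, mul_assoc] at h'
    exact mul_left_cancel h'
  rw [h, hb1, mul_one]
  exact hc

end Factorization

/-- In a finite group, let `N ≠ ⊥` be an abelian normal subgroup of `AB`, with `A` and `B`
abelian. Then some nontrivial element of `N` is fixed by `A ∩ BN`. -/
theorem exists_fixed_ne_one_of_mul_abelian {G : Type*} [Group G] [Finite G] {A B N : Subgroup G}
    [N.Normal] (hA : ∀ x ∈ A, ∀ y ∈ A, x * y = y * x)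
    (hB : ∀ x ∈ B, ∀ y ∈ B, x * y = y * x) (hN : ∀ x ∈ N, ∀ y ∈ N, x * y = y * x)
    (hfact : ∀ g : G, ∃ a ∈ A, ∃ b ∈ B, g = a * b) (hne : N ≠ ⊥) :
    ∃ v ∈ N, v ≠ 1 ∧ ∀ a ∈ A, ∀ n ∈ N, n * a ∈ B → a * v = v * a := by
  let _ : CommGroup N := { (inferInstance : Group N) with
    mul_comm := fun x y => Subtype.ext (hN x x.2 y y.2) }
  have : Nontrivial N := (Subgroup.nontrivial_iff_ne_bot N).2 hne
  let ι := {p : A × N // (p.2 * p.1 : G) ∈ B}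
  let ρ : ι → AddMonoid.End (Additive N) := fun i =>
    MonoidHom.toAdditive (MulAut.conjNormal (i.1.1 : G) : MulAut N).toMonoidHom
  have hρ (i : ι) (x : N) : ((ρ i (Additive.ofMul x)).toMul : G) = i.1.1 * x * (i.1.1 : G)⁻¹ :=
    MulAut.conjNormal_apply _ _
  have hcomm (i j : ι) : Commute (ρ i) (ρ j) := by
    refine AddMonoidHom.ext fun x => Subtype.ext ?_
    change (i.1.1 : G) * (j.1.1 * x.toMul * (j.1.1 : G)⁻¹) * (i.1.1 : G)⁻¹
      = j.1.1 * (i.1.1 * x.toMul * (i.1.1 : G)⁻¹) * (j.1.1 : G)⁻¹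
    have h := hA i.1.1 i.1.1.2 j.1.1 j.1.1.2
    calc _ = (i.1.1 * j.1.1 : G) * x.toMul * (i.1.1 * j.1.1 : G)⁻¹ := by group
      _ = _ := by rw [h]; group
  have hinj (i : ι) : Function.Injective (ρ i) :=
    (MulAut.conjNormal (i.1.1 : G) : MulAut N).injective
  let δ : ι → Additive N := fun i => Additive.ofMul i.1.2
  have hδ : Function.Surjective δ := by
    intro x
    obtain ⟨b, hb, a, ha, h⟩ := exists_eq_mul_swap hfact (x.toMul : G)
    exact ⟨⟨(⟨a⁻¹, A.inv_mem ha⟩, x.toMul), by simpa [h] using hb⟩, rfl⟩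
  have hsymm (i j : ι) : δ i + ρ i (δ j) = δ j + ρ j (δ i) := by
    refine Subtype.ext ?_
    change (i.1.2 : G) * (i.1.1 * j.1.2 * (i.1.1 : G)⁻¹)
      = j.1.2 * (j.1.1 * i.1.2 * (j.1.1 : G)⁻¹)
    have h := hA i.1.1 i.1.1.2 j.1.1 j.1.1.2
    have h' := hB _ i.2 _ j.2
    calc _ = (i.1.2 * i.1.1 : G) * (j.1.2 * j.1.1) * (i.1.1 * j.1.1 : G)⁻¹ := by group
      _ = _ := by rw [h', h]; group
  obtain ⟨v, hv, hfix⟩ := exists_ne_zero_forall_apply_eq_zero_of_isNilpotent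
    (fun i => ρ i - 1)
    (fun i j => ((hcomm i j).sub_left (Commute.one_left _)).sub_right (Commute.one_right _))
    (isNilpotent_sub_one_of_surjective_crossed ρ hcomm hinj δ hδ hsymm)
  refine ⟨v.toMul, v.toMul.2, fun h => hv (Subtype.ext h), fun a ha n hn hna => ?_⟩
  have h : ρ ⟨(⟨a, ha⟩, ⟨n, hn⟩), hna⟩ v = v := sub_eq_zero.1 (hfix _)
  have hval := (hρ ⟨(⟨a, ha⟩, ⟨n, hn⟩), hna⟩ v.toMul).symm.trans
    (congrArg (fun x : Additive N => (x.toMul : G)) h)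
  exact mul_inv_eq_iff_eq_mul.1 hval

/-- Itô: in a nontrivial finite group which is a product of two abelian subgroups, one
of the factors contains a nontrivial normal subgroup of the whole group. -/
theorem exists_normal_of_mul_abelian {G : Type*} [Group G] [Finite G] [Nontrivial G]
    (A B : Subgroup G)
    (hA : ∀ x ∈ A, ∀ y ∈ A, x * y = y * x)
    (hB : ∀ x ∈ B, ∀ y ∈ B, x * y = y * x)
    (hfact : ∀ g : G, ∃ a ∈ A, ∃ b ∈ B, g = a * b) :
    A.normalCore ≠ ⊥ ∨ B.normalCore ≠ ⊥ := by
  by_contra! ⟨hAcore, hBcore⟩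
  have hfact' := exists_eq_mul_swap hfact
  obtain ⟨N, hNormal, hN, hAB⟩ := exists_normal_abelian_of_mul_abelian hA hB hfact
  have hBA : ∀ b ∈ B, ∀ a ∈ A, ⁅b, a⁆ ∈ N := fun b hb a ha => by
    rw [← commutatorElement_inv]
    exact N.inv_mem (hAB a ha b hb)
  have hcentA {a : G} (ha : a ∈ A) (haN : ∀ n ∈ N, n * a = a * n) : a = 1 :=
    eq_one_of_mem_of_commute_normal hA hB hfact hAcore hBcore hAB ha haN
  have hcentB {b : G} (hb : b ∈ B) (hbN : ∀ n ∈ N, n * b = b * n) : b = 1 :=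
    eq_one_of_mem_of_commute_normal hB hA hfact' hBcore hAcore hBA hb hbN
  have hne : N ≠ ⊥ := by
    rintro rfl
    obtain ⟨g, hg⟩ := exists_ne (1 : G)
    obtain ⟨a, ha, b, hb, rfl⟩ := hfact g
    refine hg ?_
    rw [hcentA ha fun n hn => ?_, hcentB hb fun n hn => ?_, mul_one] <;>
    simp [Subgroup.mem_bot.1 hn]
  obtain ⟨v, hvN, hv, hfix⟩ := exists_fixed_ne_one_of_mul_abelian hA hB hN hfact hne
  obtain ⟨a, ha, b, hb, rfl⟩ := hfact v
  have hab : a * b = b * a := by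
    have h := hfix a⁻¹ (A.inv_mem ha) (a⁻¹ * (a * b) * a)
      (by simpa using hNormal.conj_mem _ hvN a⁻¹) (by simpa using hb)
    rw [inv_mul_cancel_left] at h
    conv_rhs => rw [h]
    group
  -- every element of `N` is a product of elements of `B ∩ AN` and `A ∩ BN`
  have hcomm (n : G) (hn : n ∈ N) : n * a = a * n ∧ n * b = b * n := by
    obtain ⟨d, hd, c, hc, rfl⟩ := hfact' n
    have hcv : c * (a * b) = a * b * c := by
      have h := hfix c⁻¹ (A.inv_mem hc) (d * c) hn (by simpa using hd)
      calc c * (a * b) = c * (a * b * c⁻¹) * c := by group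
        _ = a * b * c := by rw [← h]; group
    have hca := hA c hc a ha
    have hdb := hB d hd b hb
    have hcb : c * b = b * c := by
      rw [← mul_assoc, hca, mul_assoc, mul_assoc] at hcv
      exact mul_left_cancel hcv
    have hdv : d * (a * b) = a * b * d := by
      have h := hN _ hn _ hvN
      rw [mul_assoc, hcv, ← mul_assoc d, ← mul_assoc (a * b)] at h
      exact mul_right_cancel h
    have hda : d * a = a * d := by
      rw [mul_assoc a b d, ← hdb, ← mul_assoc, ← mul_assoc] at hdv
      exact mul_right_cancel hdv
    exact ⟨by rw [mul_assoc, hca, ← mul_assoc, hda, mul_assoc],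
      by rw [mul_assoc, hcb, ← mul_assoc, hdb, mul_assoc]⟩
  refine hv ?_
  rw [hcentA ha fun n hn => (hcomm n hn).1, hcentB hb fun n hn => (hcomm n hn).2, mul_one]
end
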